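/- arXiv:1110.5888 — 6 statements merged into one kernel-verified Lean document; each statement's English description precedes it below -/
import Mathlib

section
/- Let k ≥ 3, 0 < ε ≤ 1, let a ≠ b be alternatives, and let f : S_k → [k] be an SCF on one voter. If P(σ ∈ B) ≥ 2ε/k^6 and P(σ ∈ B | σ ∈ F̄) ≤ 1 − ε/(4k), then either P(σ ∈ LD(a,b)) ≥ ε^2/(2k^10) or P(σ ∈ M_3(f)) ≥ ε^2/(4k^12). -/
open Finset

/-- `a` is ranked above `b` in the ranking `τ` (a ranking maps positions to
alternatives; earlier positions are better). -/
def Above {k : ℕ} (τ : Equiv.Perm (Fin k)) (a b : Fin k) : Prop :=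
  τ.symm a < τ.symm b

/-- Uniform probability of an event over a finite type. -/
noncomputable def prob {Ω : Type*} [Fintype Ω] (p : Ω → Prop) : ℝ := by
  classical exact ((Finset.univ.filter p).card : ℝ) / (Fintype.card Ω : ℝ)

/-- `τ` and `τ'` agree outside a block of at most `r` consecutive positions. -/
def AgreeOutsideBlock {k : ℕ} (r : ℕ) (τ τ' : Equiv.Perm (Fin k)) : Prop :=
  ∃ l : ℕ, ∀ p : Fin k, ((p : ℕ) < l ∨ l + r ≤ (p : ℕ)) → τ p = τ' p

/-- `σ` is a manipulation point of the one-voter SCF `f`. -/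
def IsMPoint1 {k : ℕ} (f : Equiv.Perm (Fin k) → Fin k) (σ : Equiv.Perm (Fin k)) : Prop :=
  ∃ σ', σ ≠ σ' ∧ Above σ (f σ') (f σ)

/-- `σ` is an `r`-manipulation point of the one-voter SCF `f`, i.e. `σ ∈ M_r(f)`. -/
def IsMPointR1 {k : ℕ} (r : ℕ) (f : Equiv.Perm (Fin k) → Fin k)
    (σ : Equiv.Perm (Fin k)) : Prop :=
  ∃ σ', σ ≠ σ' ∧ Above σ (f σ') (f σ) ∧ AgreeOutsideBlock r σ σ'

/-- `f = top_H`: `f` always elects the top alternative among `H`. -/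
def IsTop1 {k : ℕ} (f : Equiv.Perm (Fin k) → Fin k) (H : Finset (Fin k)) : Prop :=
  ∀ σ, f σ ∈ H ∧ ∀ b ∈ H, b ≠ f σ → Above σ (f σ) b

/-- `f` takes exactly two values. -/
def TakesExactlyTwoValues1 {k : ℕ} (f : Equiv.Perm (Fin k) → Fin k) : Prop :=
  ∃ a b : Fin k, a ≠ b ∧ (∀ σ, f σ = a ∨ f σ = b) ∧ (∃ σ, f σ = a) ∧ (∃ σ, f σ = b)

/-- `f` is monotone (one-voter version). -/
def IsMonotone1 {k : ℕ} (f : Equiv.Perm (Fin k) → Fin k) : Prop :=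
  ∀ σ σ', f σ ≠ f σ' → Above σ' (f σ') (f σ)

/-- The family `NONMANIP(1,k)` of nonmanipulable one-voter social choice functions. -/
def InNonManip1 {k : ℕ} (f : Equiv.Perm (Fin k) → Fin k) : Prop :=
  (∃ H : Finset (Fin k), H.Nonempty ∧ IsTop1 f H) ∨
  (TakesExactlyTwoValues1 f ∧ IsMonotone1 f)

/-- `[a:b]σ`: swap `a` and `b` in `σ` if they occupy adjacent positions,
and `σ` otherwise. -/
def adjSwap {k : ℕ} (a b : Fin k) (σ : Equiv.Perm (Fin k)) : Equiv.Perm (Fin k) :=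
  if (σ.symm a : ℕ) + 1 = (σ.symm b : ℕ) ∨ (σ.symm b : ℕ) + 1 = (σ.symm a : ℕ)
  then Equiv.swap a b * σ else σ

/-- `σ ∈ F̄`: `a` occupies the position directly above `b` in `σ`. -/
def Fbar {k : ℕ} (a b : Fin k) (σ : Equiv.Perm (Fin k)) : Prop :=
  (σ.symm a : ℕ) + 1 = (σ.symm b : ℕ)

/-- `σ ∈ B`: `f σ = a`, `f([a:b]σ) = b` and `a` is above `b` in `σ`. -/
def BSet {k : ℕ} (f : Equiv.Perm (Fin k) → Fin k) (a b : Fin k)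
    (σ : Equiv.Perm (Fin k)) : Prop :=
  f σ = a ∧ f (adjSwap a b σ) = b ∧ Above σ a b

/-- Adjacency in the graph `G` on `F̄`: transposing two elements in adjacent positions
when the adjacent pair `a,b` is treated as a single block element (either swapping two
elements neither of which is `a` or `b`, or moving the `a,b`-block up or down by one). -/
def GAdj {k : ℕ} (a b : Fin k) (σ π : Equiv.Perm (Fin k)) : Prop :=
  Fbar a b σ ∧ Fbar a b π ∧
    ((∃ p q : Fin k, (p : ℕ) + 1 = (q : ℕ) ∧ σ p ≠ a ∧ σ p ≠ b ∧ σ q ≠ a ∧ σ q ≠ b ∧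
        π = σ * Equiv.swap p q) ∨
     (∃ p q r : Fin k, (p : ℕ) + 1 = (q : ℕ) ∧ (q : ℕ) + 1 = (r : ℕ) ∧ σ q = a ∧ σ r = b ∧
        π = σ * (Equiv.swap p r * Equiv.swap p q)) ∨
     (∃ p q r : Fin k, (p : ℕ) + 1 = (q : ℕ) ∧ (q : ℕ) + 1 = (r : ℕ) ∧ σ p = a ∧ σ q = b ∧
        π = σ * (Equiv.swap p q * Equiv.swap p r)))

/-- `σ ∈ ∂(B)`: `σ ∈ B` and `σ` has a `G`-neighbor in `F̄ ∖ B`. -/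
def InBdryB {k : ℕ} (f : Equiv.Perm (Fin k) → Fin k) (a b : Fin k)
    (σ : Equiv.Perm (Fin k)) : Prop :=
  BSet f a b σ ∧ ∃ π, GAdj a b σ π ∧ ¬ BSet f a b π

/-- `σ ∈ LD^H`: `σ` is a local dictator on `H`: the alternatives of `H` occupy a block
of consecutive positions in `σ`, and for every `σ'` obtained from `σ` by permuting the
alternatives of `H` within this block, `f σ'` is the top-ranked alternative of `H` in `σ'`. -/
def IsLocalDict {k : ℕ} (f : Equiv.Perm (Fin k) → Fin k) (H : Finset (Fin k))
    (σ : Equiv.Perm (Fin k)) : Prop :=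
  (∃ l : ℕ, ∀ x : Fin k, σ x ∈ H ↔ l ≤ (x : ℕ) ∧ (x : ℕ) < l + H.card) ∧
  ∀ σ' : Equiv.Perm (Fin k), (∀ x, σ x ∉ H → σ' x = σ x) →
    f σ' ∈ H ∧ ∀ c ∈ H, c ≠ f σ' → Above σ' (f σ') c

/-- `σ ∈ LD(a,b) = ∪_{c ∉ {a,b}} LD^{{a,b,c}}`. -/
def InLD {k : ℕ} (f : Equiv.Perm (Fin k) → Fin k) (a b : Fin k)
    (σ : Equiv.Perm (Fin k)) : Prop :=
  ∃ c, c ≠ a ∧ c ≠ b ∧ IsLocalDict f ({a, b, c} : Finset (Fin k)) σ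

/-- `τ'` is obtained from `τ` by moving only the alternative `c` (the relative order of
all other alternatives is unchanged). -/
def MovedOnly {k : ℕ} (c : Fin k) (τ τ' : Equiv.Perm (Fin k)) : Prop :=
  ∀ x y, x ≠ c → y ≠ c → (Above τ x y ↔ Above τ' x y)

/-- `σ ∈ V_{(a,b,c)}`: the top three positions of `σ` hold `a`, `b`, `c` in this order. -/
def VSet {k : ℕ} (a b c : Fin k) (σ : Equiv.Perm (Fin k)) : Prop :=
  ∃ p q r : Fin k, (p : ℕ) = 0 ∧ (q : ℕ) = 1 ∧ (r : ℕ) = 2 ∧ σ p = a ∧ σ q = b ∧ σ r = c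

/-- Adjacency in the graph `G_{(a,b,c)}`: both in `V_{(a,b,c)}` and differing by
transposing the alternatives in two adjacent positions. -/
def VAdj {k : ℕ} (a b c : Fin k) (σ π : Equiv.Perm (Fin k)) : Prop :=
  VSet a b c σ ∧ VSet a b c π ∧ σ ≠ π ∧
    ∃ p q : Fin k, (p : ℕ) + 1 = (q : ℕ) ∧ π = σ * Equiv.swap p q

/-- `σ ∈ T(a,b,c) = V_{(a,b,c)} ∩ LD^{{a,b,c}}`. -/
def TSet {k : ℕ} (f : Equiv.Perm (Fin k) → Fin k) (a b c : Fin k)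
    (σ : Equiv.Perm (Fin k)) : Prop :=
  VSet a b c σ ∧ IsLocalDict f ({a, b, c} : Finset (Fin k)) σ

/-- `σ ∈ ∂(T(a,b,c))`. -/
def InBdryT {k : ℕ} (f : Equiv.Perm (Fin k) → Fin k) (a b c : Fin k)
    (σ : Equiv.Perm (Fin k)) : Prop :=
  TSet f a b c σ ∧ ∃ π, VAdj a b c σ π ∧ ¬ TSet f a b c π


namespace S14

open Equiv

theorem agree_symm {k r : ℕ} {τ τ' : Perm (Fin k)} (h : AgreeOutsideBlock r τ τ') :
    AgreeOutsideBlock r τ' τ := by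
  obtain ⟨l, hl⟩ := h
  exact ⟨l, fun p hp => (hl p hp).symm⟩

theorem above_total {k : ℕ} (τ : Perm (Fin k)) {x y : Fin k} (h : x ≠ y) (h' : ¬ Above τ x y) :
    Above τ y x := by
  unfold Above at *
  rcases lt_trichotomy (τ.symm x) (τ.symm y) with h1 | h1 | h1
  · exact absurd h1 h'
  · exact absurd (τ.symm.injective h1) h
  · exact h1

/-- If the outcome changes within a block while the relative order of the two outcomes is
unchanged, one of the two points is a manipulation point. -/
theorem manip {k : ℕ} (f : Perm (Fin k) → Fin k) (τ τ' : Perm (Fin k))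
    (hag : AgreeOutsideBlock 3 τ τ') (hne : f τ ≠ f τ')
    (hord : Above τ (f τ) (f τ') → Above τ' (f τ) (f τ')) :
    IsMPointR1 3 f τ ∨ IsMPointR1 3 f τ' := by
  have hττ : τ ≠ τ' := fun h => hne (by rw [h])
  by_cases h : Above τ (f τ) (f τ')
  · exact Or.inr ⟨τ, hττ.symm, hord h, agree_symm hag⟩
  · exact Or.inl ⟨τ', hττ, above_total τ hne h, hag⟩

theorem case_one {k : ℕ} (f : Perm (Fin k) → Fin k) (τ : Perm (Fin k)) (p q : Fin k)
    (hpq : (p : ℕ) + 1 = q) (h1 : τ p ≠ f τ) (h2 : τ q ≠ f τ) (hne : f (τ * swap p q) ≠ f τ) :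
    IsMPointR1 3 f τ ∨ IsMPointR1 3 f (τ * swap p q) := by
  refine manip f τ _ ⟨p, ?_⟩ hne.symm ?_
  · intro x hx
    have hxp : x ≠ p := by rintro rfl; omega
    have hxq : x ≠ q := by rintro rfl; omega
    simp [swap_apply_of_ne_of_ne hxp hxq]
  · intro h
    generalize f (τ * swap p q) = y at *
    generalize f τ = x at *
    unfold Above at *
    have e : ∀ z, (τ * swap p q).symm z = swap p q (τ.symm z) := by
      intro z
      rw [Equiv.symm_apply_eq]; simp
    rw [e, e]
    have hx1 : τ.symm x ≠ p := by rintro h; apply h1; rw [← h]; simp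
    have hx2 : τ.symm x ≠ q := by rintro h; apply h2; rw [← h]; simp
    rw [swap_apply_of_ne_of_ne hx1 hx2]
    generalize τ.symm x = u at *
    generalize τ.symm y = w at *
    have hu1 : (u : ℕ) ≠ p := fun h => hx1 (Fin.ext h)
    have hu2 : (u : ℕ) ≠ q := fun h => hx2 (Fin.ext h)
    rw [swap_apply_def]
    rw [Fin.lt_def] at *
    split_ifs with g1 g2
    · subst g1; omega
    · subst g2; omega
    · exact h

theorem fix_outside {k : ℕ} (a b c : Fin k) (hab : a ≠ b) (hca : c ≠ a) (hcb : c ≠ b)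
    (v : Perm (Fin k)) (hv : ∀ z, z ≠ a → z ≠ b → z ≠ c → v z = z) :
    ∃ x y, v = swap b y * swap a x := by
  obtain ⟨u, hu⟩ : ∃ u, u = swap b (v b) * v := ⟨_, rfl⟩
  have hub : u b = b := by rw [hu]; simp
  have hvb : v b = a ∨ v b = b ∨ v b = c := by
    by_contra hcon
    push Not at hcon
    have := hv (v b) hcon.1 hcon.2.1 hcon.2.2
    exact hcon.2.1 (v.injective this)
  have huz : ∀ z, z ≠ a → z ≠ b → z ≠ c → u z = z := by
    intro z h1 h2 h3
    rw [hu, Perm.mul_apply, hv z h1 h2 h3]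
    apply swap_apply_of_ne_of_ne h2
    rcases hvb with h | h | h <;> rw [h] <;> assumption
  have hua : u a = a ∨ u a = c := by
    by_contra hcon
    push Not at hcon
    have hb : u a ≠ b := by
      intro h
      exact hab (u.injective (h.trans hub.symm))
    have := huz (u a) hcon.1 hb hcon.2
    exact hcon.1 (u.injective this)
  have huc : u c = a ∨ u c = c := by
    by_contra hcon
    push Not at hcon
    have hb : u c ≠ b := by
      intro h
      exact hcb (u.injective (h.trans hub.symm))
    have := huz (u c) hcon.1 hb hcon.2
    exact hcon.2 (u.injective this)
  have hac : u a ≠ u c := fun h => hca (u.injective h).symm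
  refine ⟨u a, v b, ?_⟩
  have h2 : u = swap a (u a) := by
    ext z
    congr 1
    rcases hua with h | h
    · rw [h, swap_self]
      have : u c = c := by
        rcases huc with h' | h'
        · exact absurd (h.trans h'.symm) hac
        · exact h'
      by_cases z1 : z = a
      · subst z1; simpa using h
      by_cases z2 : z = b
      · subst z2; simpa using hub
      by_cases z3 : z = c
      · subst z3; simpa using this
      simpa using huz z z1 z2 z3
    · rw [h]
      have : u c = a := by
        rcases huc with h' | h'
        · exact h'
        · exact absurd (h.trans h'.symm) hac
      by_cases z1 : z = a
      · subst z1; simpa using h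
      by_cases z2 : z = b
      · subst z2; rw [swap_apply_of_ne_of_ne hab.symm hcb.symm]; exact hub
      by_cases z3 : z = c
      · subst z3; simpa using this
      rw [swap_apply_of_ne_of_ne z1 z3]
      exact huz z z1 z2 z3
  rw [← h2, hu, ← mul_assoc, swap_mul_self, one_mul]

/-- The case in which the block `a,b` is moved past `c`. -/
theorem case_two {k : ℕ} (f : Perm (Fin k) → Fin k) (a b c : Fin k) (hab : a ≠ b)
    (hca : c ≠ a) (hcb : c ≠ b) (σ π : Perm (Fin k)) (l : ℕ)
    (hl : ∀ x : Fin k, σ x ∈ ({a, b, c} : Finset (Fin k)) ↔ l ≤ (x : ℕ) ∧ (x : ℕ) < l + 3)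
    (h1 : f σ = a) (h2 : f (swap a b * σ) = b) (hπF : Fbar a b π)
    (hπ : ∀ x, σ x ∉ ({a, b, c} : Finset (Fin k)) → π x = σ x)
    (hn : f π ≠ a ∨ f (swap a b * π) ≠ b)
    (hM : ∀ x y, ¬ IsMPointR1 3 f ((swap b y * swap a x) * σ)) :
    IsLocalDict f ({a, b, c} : Finset (Fin k)) σ := by
  set H : Finset (Fin k) := {a, b, c} with hH
  have hHc : H.card = 3 := by
    rw [hH, Finset.card_eq_three]
    exact ⟨a, b, c, hab, hca.symm, hcb.symm, rfl⟩
  have hswap : ∀ τ : Perm (Fin k), (∀ x, σ x ∉ H → τ x = σ x) →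
      (∀ x, σ x ∉ H → (swap a b * τ) x = σ x) := by
    intro τ hτ x hx
    rw [Perm.mul_apply, hτ x hx]
    apply swap_apply_of_ne_of_ne
    · intro h; apply hx; simp [hH, h]
    · intro h; apply hx; simp [hH, h]
  have hNM : ∀ τ : Perm (Fin k), (∀ x, σ x ∉ H → τ x = σ x) → ¬ IsMPointR1 3 f τ := by
    intro τ hτ
    obtain ⟨x, y, hxy⟩ := fix_outside a b c hab hca hcb (τ * σ⁻¹) (by
      intro z z1 z2 z3
      have := hτ (σ⁻¹ z) (by simp [hH, z1, z2, z3])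
      simpa using this)
    have := hM x y
    rw [← hxy] at this
    simpa using this
  have hag : ∀ τ τ' : Perm (Fin k), (∀ x, σ x ∉ H → τ x = σ x) → (∀ x, σ x ∉ H → τ' x = σ x) →
      AgreeOutsideBlock 3 τ τ' := by
    intro τ τ' hτ hτ'
    refine ⟨l, fun p hp => ?_⟩
    have : σ p ∉ H := by rw [hl]; omega
    rw [hτ p this, hτ' p this]
  have hout : ∀ τ : Perm (Fin k), (∀ x, σ x ∉ H → τ x = σ x) → ∀ z, z ∉ H →
      τ.symm z = σ.symm z := by
    intro τ hτ z hz
    rw [Equiv.symm_apply_eq, hτ]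
    · simp
    · simpa using hz
  have hin : ∀ τ : Perm (Fin k), (∀ x, σ x ∉ H → τ x = σ x) → ∀ z, z ∈ H →
      l ≤ (τ.symm z : ℕ) ∧ (τ.symm z : ℕ) < l + 3 := by
    intro τ hτ z hz
    rw [← hl]
    by_contra hcon
    have := hτ _ hcon
    rw [Equiv.apply_symm_apply] at this
    exact hcon (this ▸ hz)
  -- a profile electing better alternative is excluded
  have hbest : ∀ τ τ' : Perm (Fin k), (∀ x, σ x ∉ H → τ x = σ x) →
      (∀ x, σ x ∉ H → τ' x = σ x) → ¬ Above τ (f τ') (f τ) := by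
    intro τ τ' hτ hτ' h
    refine hNM τ hτ ⟨τ', ?_, h, hag τ τ' hτ hτ'⟩
    rintro rfl
    exact lt_irrefl _ h
  have hσ : ∀ x, σ x ∉ H → σ x = σ x := fun _ _ => rfl
  have hrange : ∀ τ : Perm (Fin k), (∀ x, σ x ∉ H → τ x = σ x) → f τ ∈ H := by
    intro τ hτ
    by_contra hcon
    have haH : a ∈ H := by simp [hH]
    have hane : f τ ≠ a := fun h => hcon (h ▸ haH)
    rcases manip f σ τ (hag σ τ hσ hτ) (by rw [h1]; exact hane.symm) (by
      rw [h1]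
      unfold Above
      rw [hout τ hτ _ hcon]
      have i1 := hin τ hτ a haH
      have i2 := hin σ hσ a haH
      have i3 : ¬ (l ≤ (σ.symm (f τ) : ℕ) ∧ (σ.symm (f τ) : ℕ) < l + 3) := by
        rw [← hl]; simpa using hcon
      rw [Fin.lt_def, Fin.lt_def]
      omega) with h | h
    · exact hNM σ hσ h
    · exact hNM τ hτ h
  have hmem : ∀ z, z ∈ H ↔ z = a ∨ z = b ∨ z = c := by intro z; simp [hH]
  have hc : ∃ τ : Perm (Fin k), (∀ x, σ x ∉ H → τ x = σ x) ∧ f τ = c := by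
    rcases hn with h | h
    · refine ⟨π, hπ, ?_⟩
      rcases (hmem _).1 (hrange π hπ) with h' | h' | h'
      · exact absurd h' h
      · exfalso
        apply hbest π σ hπ hσ
        rw [h1, h']
        unfold Above; unfold Fbar at hπF
        rw [Fin.lt_def]; omega
      · exact h'
    · refine ⟨swap a b * π, hswap π hπ, ?_⟩
      rcases (hmem _).1 (hrange _ (hswap π hπ)) with h' | h' | h'
      · exfalso
        apply hbest _ (swap a b * σ) (hswap π hπ) (hswap σ hσ)
        rw [h2, h']
        unfold Above; unfold Fbar at hπF
        have e1 : (swap a b * π).symm a = π.symm b := by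
          rw [Equiv.symm_apply_eq]; simp
        have e2 : (swap a b * π).symm b = π.symm a := by
          rw [Equiv.symm_apply_eq]; simp
        rw [e1, e2, Fin.lt_def]; omega
      · exact absurd h' h
      · exact h'
  refine ⟨⟨l, by rw [hHc]; exact hl⟩, ?_⟩
  intro τ hτ
  refine ⟨hrange τ hτ, ?_⟩
  intro d hd hdne
  have hatt : ∃ τ' : Perm (Fin k), (∀ x, σ x ∉ H → τ' x = σ x) ∧ f τ' = d := by
    rcases (hmem d).1 hd with h | h | h
    · exact ⟨σ, hσ, h1.trans h.symm⟩
    · exact ⟨_, hswap σ hσ, h2.trans h.symm⟩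
    · rw [h]; exact hc
  obtain ⟨τ', hτ', hfd⟩ := hatt
  apply above_total τ hdne
  rw [← hfd]
  exact hbest τ τ' hτ hτ'

theorem adjSwap_of_fbar {k : ℕ} {a b : Fin k} {σ : Perm (Fin k)} (h : Fbar a b σ) :
    adjSwap a b σ = swap a b * σ := by
  unfold adjSwap Fbar at *
  rw [if_pos (Or.inl h)]

theorem bset_fbar {k : ℕ} {f : Perm (Fin k) → Fin k} {a b : Fin k} (hab : a ≠ b)
    {σ : Perm (Fin k)} (h : BSet f a b σ) : Fbar a b σ := by
  obtain ⟨h1, h2, h3⟩ := h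
  by_contra hF
  unfold adjSwap at h2
  unfold Fbar at hF
  unfold Above at h3
  rw [Fin.lt_def] at h3
  rw [if_neg (by omega)] at h2
  exact hab (h1.symm.trans h2)

/-- The set of left multipliers. -/
def Gam {k : ℕ} (a b : Fin k) : Finset (Perm (Fin k)) :=
  ((Finset.univ : Finset (Fin k × Fin k)).image (fun z => swap b z.2 * swap a z.1)) ∪
  (((Finset.univ : Finset (Fin k × Fin k)).image (fun z => swap z.1 z.2)) ∪
  ((Finset.univ : Finset (Fin k × Fin k)).image (fun z => swap a b * swap z.1 z.2)))

theorem gam_card {k : ℕ} (a b : Fin k) : (Gam a b).card ≤ 3 * k ^ 2 := by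
  have hc : (Finset.univ : Finset (Fin k × Fin k)).card = k ^ 2 := by
    simp [sq]
  unfold Gam
  refine (Finset.card_union_le _ _).trans ?_
  have h1 := Finset.card_image_le (s := (Finset.univ : Finset (Fin k × Fin k)))
    (f := fun z => swap b z.2 * swap a z.1)
  have h2 := Finset.card_image_le (s := (Finset.univ : Finset (Fin k × Fin k)))
    (f := fun z => swap z.1 z.2)
  have h3 := Finset.card_image_le (s := (Finset.univ : Finset (Fin k × Fin k)))
    (f := fun z => swap a b * swap z.1 z.2)
  have h4 := Finset.card_union_le
    ((Finset.univ : Finset (Fin k × Fin k)).image (fun z => swap z.1 z.2))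
    ((Finset.univ : Finset (Fin k × Fin k)).image (fun z => swap a b * swap z.1 z.2))
  rw [hc] at h1 h2 h3
  omega

theorem bdry_local {k : ℕ} (f : Perm (Fin k) → Fin k) (a b : Fin k) (hab : a ≠ b)
    (σ : Perm (Fin k)) (h : InBdryB f a b σ) :
    InLD f a b σ ∨ ∃ u ∈ Gam a b, IsMPointR1 3 f (u * σ) := by
  by_cases hM : ∃ u ∈ Gam a b, IsMPointR1 3 f (u * σ)
  · exact Or.inr hM
  push Not at hM
  left
  have hM1 : ∀ x y, ¬ IsMPointR1 3 f ((swap b y * swap a x) * σ) := by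
    intro x y
    apply hM
    unfold Gam
    rw [Finset.mem_union]; left
    exact Finset.mem_image.2 ⟨(x, y), Finset.mem_univ _, rfl⟩
  have hM2 : ∀ x y, ¬ IsMPointR1 3 f (swap x y * σ) := by
    intro x y
    apply hM
    unfold Gam
    rw [Finset.mem_union, Finset.mem_union]; right; left
    exact Finset.mem_image.2 ⟨(x, y), Finset.mem_univ _, rfl⟩
  have hM3 : ∀ x y, ¬ IsMPointR1 3 f ((swap a b * swap x y) * σ) := by
    intro x y
    apply hM
    unfold Gam
    rw [Finset.mem_union, Finset.mem_union]; right; right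
    exact Finset.mem_image.2 ⟨(x, y), Finset.mem_univ _, rfl⟩
  obtain ⟨⟨h1, h2, h3⟩, π, ⟨hF, hFπ, hadj⟩, hπ⟩ := h
  rw [adjSwap_of_fbar hF] at h2
  have hn : f π ≠ a ∨ f (swap a b * π) ≠ b := by
    by_contra hcon
    push Not at hcon
    apply hπ
    refine ⟨hcon.1, ?_, ?_⟩
    · rw [adjSwap_of_fbar hFπ]; exact hcon.2
    · unfold Above; unfold Fbar at hFπ; rw [Fin.lt_def]; omega
  rcases hadj with ⟨p, q, hpq, pa, pb, qa, qb, rfl⟩ | ⟨p, q, r, hpq, hqr, hqa, hrb, rfl⟩ |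
    ⟨p, q, r, hpq, hqr, hpa, hqb, rfl⟩
  · exfalso
    rcases hn with hn | hn
    · rcases case_one f σ p q hpq (by rw [h1]; exact pa) (by rw [h1]; exact qa)
        (by rw [h1]; exact hn) with h | h
      · apply hM2 a a; rw [swap_self]; exact h
      · apply hM2 (σ p) (σ q)
        rw [← Equiv.mul_swap_eq_swap_mul]; exact h
    · rcases case_one f (swap a b * σ) p q hpq
        (by rw [h2, Perm.mul_apply, swap_apply_of_ne_of_ne pa pb]; exact pb)
        (by rw [h2, Perm.mul_apply, swap_apply_of_ne_of_ne qa qb]; exact qb)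
        (by rw [h2, mul_assoc]; exact hn) with h | h
      · exact hM2 a b h
      · apply hM3 (σ p) (σ q)
        rw [mul_assoc, ← Equiv.mul_swap_eq_swap_mul, ← mul_assoc]; exact h
  · have hpq' : p ≠ q := by rintro rfl; omega
    have hpr' : p ≠ r := by rintro rfl; omega
    have hqr' : q ≠ r := by rintro rfl; omega
    have hca : σ p ≠ a := fun h => hpq' (σ.injective (h.trans hqa.symm))
    have hcb : σ p ≠ b := fun h => hpr' (σ.injective (h.trans hrb.symm))
    have hl : ∀ x : Fin k, σ x ∈ ({a, b, σ p} : Finset (Fin k)) ↔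
        (p : ℕ) ≤ (x : ℕ) ∧ (x : ℕ) < p + 3 := by
      intro x
      rw [← hqa, ← hrb]
      simp only [Finset.mem_insert, Finset.mem_singleton, σ.injective.eq_iff, Fin.ext_iff]
      omega
    refine ⟨σ p, hca, hcb, case_two f a b (σ p) hab hca hcb σ _ p hl h1 h2 hFπ ?_ hn hM1⟩
    intro x hx
    rw [hl] at hx
    have x1 : x ≠ p := by rintro rfl; omega
    have x2 : x ≠ q := by rintro rfl; omega
    have x3 : x ≠ r := by rintro rfl; omega
    simp [swap_apply_of_ne_of_ne, x1, x2, x3]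
  · have hpq' : p ≠ q := by rintro rfl; omega
    have hpr' : p ≠ r := by rintro rfl; omega
    have hqr' : q ≠ r := by rintro rfl; omega
    have hca : σ r ≠ a := fun h => hpr' (σ.injective (h.trans hpa.symm)).symm
    have hcb : σ r ≠ b := fun h => hqr' (σ.injective (h.trans hqb.symm)).symm
    have hl : ∀ x : Fin k, σ x ∈ ({a, b, σ r} : Finset (Fin k)) ↔
        (p : ℕ) ≤ (x : ℕ) ∧ (x : ℕ) < p + 3 := by
      intro x
      rw [← hpa, ← hqb]
      simp only [Finset.mem_insert, Finset.mem_singleton, σ.injective.eq_iff, Fin.ext_iff]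
      omega
    refine ⟨σ r, hca, hcb, case_two f a b (σ r) hab hca hcb σ _ p hl h1 h2 hFπ ?_ hn hM1⟩
    intro x hx
    rw [hl] at hx
    have x1 : x ≠ p := by rintro rfl; omega
    have x2 : x ≠ q := by rintro rfl; omega
    have x3 : x ≠ r := by rintro rfl; omega
    simp [swap_apply_of_ne_of_ne, x1, x2, x3]

/-- Counting form of the local lemma. -/
theorem bdry_count {k : ℕ} (f : Perm (Fin k) → Fin k) (a b : Fin k) (hab : a ≠ b) :
    Nat.card {σ // InBdryB f a b σ} ≤
      Nat.card {σ // InLD f a b σ} + 3 * k ^ 2 * Nat.card {σ // IsMPointR1 3 f σ} := by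
  classical
  simp only [Nat.card_eq_fintype_card, Fintype.card_subtype]
  have hsub : (Finset.univ.filter fun σ => InBdryB f a b σ) ⊆
      (Finset.univ.filter fun σ => InLD f a b σ) ∪
        (Gam a b).biUnion (fun u => Finset.univ.filter fun σ => IsMPointR1 3 f (u * σ)) := by
    intro σ hσ
    simp only [Finset.mem_filter, Finset.mem_univ, true_and, Finset.mem_union,
      Finset.mem_biUnion] at *
    exact bdry_local f a b hab σ hσ
  refine (Finset.card_le_card hsub).trans ((Finset.card_union_le _ _).trans ?_)
  apply Nat.add_le_add_left
  refine (Finset.card_biUnion_le).trans ?_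
  have : ∀ u ∈ Gam a b, (Finset.univ.filter fun σ => IsMPointR1 3 f (u * σ)).card ≤
      (Finset.univ.filter fun σ => IsMPointR1 3 f σ).card := by
    intro u _
    apply Finset.card_le_card_of_injOn (fun σ => u * σ)
    · intro σ hσ; simpa using hσ
    · intro x _ y _ h; exact mul_left_cancel h
  refine (Finset.sum_le_card_nsmul _ _ _ this).trans ?_
  rw [smul_eq_mul]
  exact Nat.mul_le_mul_right _ (gam_card a b)

/-! ### Isoperimetry -/

/-- Number of elements of `S` moved out of `S` by right multiplication by `g`. -/
noncomputable def cross {m : ℕ} (S : Finset (Perm (Fin m))) (g : Perm (Fin m)) : ℕ :=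
  (S.filter fun ρ => ρ * g ∉ S).card

theorem cross_mul {m : ℕ} (S : Finset (Perm (Fin m))) (g h : Perm (Fin m)) :
    cross S (g * h) ≤ cross S g + cross S h := by
  classical
  unfold cross
  have : (S.filter fun ρ => ρ * (g * h) ∉ S) ⊆
      (S.filter fun ρ => ρ * g ∉ S) ∪ (S.filter fun ρ => ρ * h ∉ S).image (fun ρ => ρ * g⁻¹) := by
    intro ρ hρ
    simp only [Finset.mem_filter, Finset.mem_union, Finset.mem_image] at *
    by_cases h1 : ρ * g ∈ S
    · right
      exact ⟨ρ * g, ⟨h1, by rw [mul_assoc]; exact hρ.2⟩, by simp⟩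
    · exact Or.inl ⟨hρ.1, h1⟩
  refine (Finset.card_le_card this).trans ((Finset.card_union_le _ _).trans ?_)
  exact Nat.add_le_add_left Finset.card_image_le _

theorem cross_one {m : ℕ} (S : Finset (Perm (Fin m))) : cross S 1 = 0 := by
  unfold cross
  rw [Finset.card_eq_zero, Finset.filter_eq_empty_iff]
  intro x hx
  simpa using hx

theorem cross_swap {m : ℕ} (S : Finset (Perm (Fin m))) (D : ℕ)
    (hD : ∀ i i' : Fin m, (i : ℕ) + 1 = i' → cross S (swap i i') ≤ D) :
    ∀ d : ℕ, ∀ i j : Fin m, (i : ℕ) + d = j → cross S (swap i j) ≤ 2 * d * D := by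
  intro d
  induction d with
  | zero =>
    intro i j h
    have : i = j := Fin.ext (by omega)
    subst this
    have : swap i i = (1 : Perm (Fin m)) := swap_self i
    rw [this, cross_one]; omega
  | succ d ih =>
    intro i j h
    by_cases hd : d = 0
    · subst hd
      have := hD i j (by omega)
      omega
    · obtain ⟨j', hj'⟩ : ∃ j' : Fin m, (j' : ℕ) + 1 = j := ⟨⟨j - 1, by omega⟩, by simp; omega⟩
      have h1 : swap i j = swap j' j * swap i j' * swap j' j := by
        have e1 : i ≠ j' := by rintro rfl; omega
        have e2 : i ≠ j := by rintro rfl; omega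
        rw [swap_comm i j]
        exact (swap_mul_swap_mul_swap e1 e2).symm
      rw [h1]
      have c1 := cross_mul S (swap j' j * swap i j') (swap j' j)
      have c2 := cross_mul S (swap j' j) (swap i j')
      have c3 := hD j' j hj'
      have c4 := ih i j' (by omega)
      calc _ ≤ D + 2 * d * D + D := by omega
        _ = 2 * (d + 1) * D := by ring

theorem cross_all {m : ℕ} (S : Finset (Perm (Fin m))) (D : ℕ)
    (hD : ∀ i i' : Fin m, (i : ℕ) + 1 = i' → cross S (swap i i') ≤ D) (g : Perm (Fin m)) :
    cross S g ≤ m * (2 * (m - 1) * D) := by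
  have hsw : ∀ i j : Fin m, cross S (swap i j) ≤ 2 * (m - 1) * D := by
    intro i j
    have key : ∀ i j : Fin m, i ≤ j → cross S (swap i j) ≤ 2 * (m - 1) * D := by
      intro i j hij
      rw [Fin.le_def] at hij
      refine (cross_swap S D hD (j - i) i j (by omega)).trans ?_
      apply Nat.mul_le_mul_right
      omega
    rcases le_total i j with h | h
    · exact key i j h
    · rw [swap_comm]; exact key j i h
  have main : ∀ n : ℕ, ∀ g : Perm (Fin m), g.support.card ≤ n →
      cross S g ≤ n * (2 * (m - 1) * D) := by
    intro n
    induction n with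
    | zero =>
      intro g hg
      have : g = 1 := by
        rw [← Perm.support_eq_empty_iff, ← Finset.card_eq_zero]; omega
      rw [this, cross_one]; omega
    | succ n ih =>
      intro g hg
      by_cases h1 : g = 1
      · rw [h1, cross_one]; omega
      · obtain ⟨x, hx⟩ : ∃ x, g x ≠ x := by
          by_contra hcon
          push Not at hcon
          exact h1 (Equiv.ext hcon)
        have hlt := Perm.card_support_swap_mul hx
        have e : g = swap x (g x) * (swap x (g x) * g) := by
          rw [← mul_assoc, swap_mul_self, one_mul]
        have c1 := cross_mul S (swap x (g x)) (swap x (g x) * g)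
        rw [← e] at c1
        have c2 := hsw x (g x)
        have c3 := ih (swap x (g x) * g) (by omega)
        calc _ ≤ 2 * (m - 1) * D + n * (2 * (m - 1) * D) := by omega
          _ = _ := by ring
  refine main m g ?_
  refine (Finset.card_le_univ _).trans ?_
  simp

theorem isoperim {m : ℕ} (S : Finset (Perm (Fin m))) (D : ℕ)
    (hD : ∀ i i' : Fin m, (i : ℕ) + 1 = i' → cross S (swap i i') ≤ D) :
    S.card * (Sᶜ).card ≤ m.factorial * (m * (2 * (m - 1) * D)) := by
  classical
  have h1 : S.card * (Sᶜ).card = ∑ g : Perm (Fin m), cross S g := by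
    unfold cross
    simp only [Finset.card_filter]
    rw [Finset.sum_comm]
    have : ∀ ρ ∈ S, (∑ g : Perm (Fin m), if ρ * g ∉ S then 1 else 0) = (Sᶜ).card := by
      intro ρ _
      rw [← Finset.card_filter]
      apply Finset.card_bij (fun g _ => ρ * g)
      · intro g hg; simpa using hg
      · intro x _ y _ h; exact mul_left_cancel h
      · intro y hy
        exact ⟨ρ⁻¹ * y, by simpa using hy, by simp⟩
    rw [Finset.sum_congr rfl this]
    simp
  rw [h1]
  refine (Finset.sum_le_card_nsmul _ _ _ (fun g _ => cross_all S D hD g)).trans ?_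
  simp [Fintype.card_perm]

/-! ### The identification of `Fbar` with a symmetric group -/

/-- Insert `b` right below `b.succAbove a'`. -/
def Phi {m : ℕ} (b : Fin (m + 1)) (a' : Fin m) (ρ : Perm (Fin m)) : Perm (Fin (m + 1)) :=
  (finSuccEquiv' (ρ.symm a').succ).trans ((optionCongr ρ).trans (finSuccEquiv' b).symm)

theorem Phi_b {m : ℕ} (b : Fin (m + 1)) (a' : Fin m) (ρ : Perm (Fin m)) (j : Fin m)
    (hj : ρ j = a') : Phi b a' ρ j.succ = b := by
  subst hj
  simp [Phi]

theorem Phi_ne {m : ℕ} (b : Fin (m + 1)) (a' : Fin m) (ρ : Perm (Fin m)) (j : Fin m)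
    (hj : ρ j = a') (x : Fin m) : Phi b a' ρ (j.succ.succAbove x) = b.succAbove (ρ x) := by
  subst hj
  simp [Phi]

theorem Phi_a {m : ℕ} (b : Fin (m + 1)) (a' : Fin m) (ρ : Perm (Fin m)) (j : Fin m)
    (hj : ρ j = a') : Phi b a' ρ j.castSucc = b.succAbove a' := by
  have := Phi_ne b a' ρ j hj j
  rw [hj] at this
  rw [← this]
  congr 1
  simp

theorem Phi_fbar {m : ℕ} (b : Fin (m + 1)) (a' : Fin m) (ρ : Perm (Fin m)) :
    Fbar (b.succAbove a') b (Phi b a' ρ) := by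
  unfold Fbar
  have h1 := Phi_b b a' ρ (ρ.symm a') (by simp)
  have h2 := Phi_a b a' ρ (ρ.symm a') (by simp)
  have e1 : (Phi b a' ρ).symm b = (ρ.symm a').succ := by rw [Equiv.symm_apply_eq, h1]
  have e2 : (Phi b a' ρ).symm (b.succAbove a') = (ρ.symm a').castSucc := by
    rw [Equiv.symm_apply_eq, h2]
  rw [e1, e2]
  simp

theorem Phi_inj {m : ℕ} (b : Fin (m + 1)) (a' : Fin m) : Function.Injective (Phi b a') := by
  intro ρ ρ' h
  have h1 := Phi_b b a' ρ (ρ.symm a') (by simp)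
  have h2 := Phi_b b a' ρ' (ρ'.symm a') (by simp)
  rw [h] at h1
  have h3 := (Phi b a' ρ').injective (h1.trans h2.symm)
  have h4 := Fin.succ_injective _ h3
  ext x
  have e1 := Phi_ne b a' ρ (ρ.symm a') (by simp) x
  have e2 := Phi_ne b a' ρ' (ρ'.symm a') (by simp) x
  rw [h, h4, e2] at e1
  rw [Fin.succAbove_right_injective e1]

theorem Phi_surj {m : ℕ} (b : Fin (m + 1)) (a' : Fin m) (σ : Perm (Fin (m + 1)))
    (h : Fbar (b.succAbove a') b σ) : ∃ ρ, Phi b a' ρ = σ := by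
  unfold Fbar at h
  obtain ⟨j, hj⟩ : ∃ j : Fin m, σ.symm b = j.succ := by
    obtain ⟨j, hj⟩ := Fin.exists_succ_eq.2 (show σ.symm b ≠ 0 by
      intro h0; rw [h0] at h; simp at h)
    exact ⟨j, hj.symm⟩
  have hja : σ.symm (b.succAbove a') = j.castSucc := by
    apply Fin.ext; rw [hj] at h; simp at h ⊢; exact h
  have hj' : σ j.succ = b := by rw [← hj]; simp
  have hja' : σ j.castSucc = b.succAbove a' := by rw [← hja]; simp
  let e : Option (Fin m) ≃ Option (Fin m) :=
    (finSuccEquiv' j.succ).symm.trans (σ.trans (finSuccEquiv' b))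
  have he : e none = none := by simp [e, hj']
  have hsome : ∀ x, some (removeNone e x) = e (some x) := by
    intro x
    apply Equiv.removeNone_some
    rcases h' : e (some x) with _ | y
    · exact absurd (e.injective (h'.trans he.symm)) (by simp)
    · exact ⟨y, rfl⟩
  have hval : ∀ x, b.succAbove (removeNone e x) = σ (j.succ.succAbove x) := by
    intro x
    have h1 := hsome x
    have h2 : (finSuccEquiv' b).symm (some (removeNone e x)) =
      (finSuccEquiv' b).symm (e (some x)) := by rw [h1]
    simpa [e] using h2
  have hρ : removeNone e j = a' := by
    apply Fin.succAbove_right_injective (p := b)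
    rw [hval, ← hja']
    congr 1
    simp
  refine ⟨removeNone e, ?_⟩
  apply Equiv.ext
  intro p
  rcases Fin.eq_self_or_eq_succAbove j.succ p with rfl | ⟨x, rfl⟩
  · rw [Phi_b _ _ _ j hρ, hj']
  · rw [Phi_ne _ _ _ j hρ, hval]

theorem Phi_eq {m : ℕ} (b : Fin (m + 1)) (a' : Fin m) (ρ s : Perm (Fin m)) (j j' : Fin m)
    (hj : ρ j = a') (hj' : s j' = j) (P : Perm (Fin (m + 1)))
    (h1 : P j'.succ = j.succ)
    (h2 : ∀ x, P (j'.succ.succAbove x) = j.succ.succAbove (s x)) :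
    Phi b a' (ρ * s) = Phi b a' ρ * P := by
  have hs : (ρ * s) j' = a' := by simp [hj', hj]
  apply Equiv.ext
  intro p
  rcases Fin.eq_self_or_eq_succAbove j'.succ p with rfl | ⟨x, rfl⟩
  · rw [Phi_b _ _ _ j' hs, Perm.mul_apply, h1, Phi_b _ _ _ j hj]
  · rw [Phi_ne _ _ _ j' hs, Perm.mul_apply, Perm.mul_apply, h2, Phi_ne _ _ _ j hj]

theorem succAbove_val {m : ℕ} (j x : Fin m) :
    ((j.succ.succAbove x : Fin (m + 1)) : ℕ) = if (x : ℕ) ≤ j then (x : ℕ) else x + 1 := by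
  unfold Fin.succAbove
  simp only [Fin.lt_def, Fin.val_castSucc, Fin.val_succ]
  split_ifs <;> simp <;> omega

theorem swap_val {m : ℕ} (p q x : Fin m) :
    ((swap p q x : Fin m) : ℕ) =
      if (x : ℕ) = p then (q : ℕ) else if (x : ℕ) = q then (p : ℕ) else x := by
  rw [swap_apply_def]
  simp only [Fin.ext_iff]
  split_ifs <;> rfl

theorem Phi_adj {m : ℕ} (b : Fin (m + 1)) (a' : Fin m) (ρ : Perm (Fin m)) (i i' : Fin m)
    (hi : (i : ℕ) + 1 = i') :
    GAdj (b.succAbove a') b (Phi b a' ρ) (Phi b a' (ρ * swap i i')) := by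
  refine ⟨Phi_fbar _ _ _, Phi_fbar _ _ _, ?_⟩
  obtain ⟨j, hj⟩ : ∃ j, ρ j = a' := ⟨ρ.symm a', by simp⟩
  by_cases h1 : i = j
  · -- the block moves down
    right; right
    subst h1
    refine ⟨i.castSucc, i.succ, i'.succ, by simp, by simp; omega, Phi_a _ _ _ _ hj,
      Phi_b _ _ _ _ hj, ?_⟩
    apply Phi_eq b a' ρ _ i i' hj (by simp)
    · apply Fin.ext
      simp only [Perm.mul_apply, swap_val, Fin.val_castSucc, Fin.val_succ]
      split_ifs <;> omega
    · intro x
      apply Fin.ext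
      simp only [Perm.mul_apply, swap_val, Fin.val_castSucc, Fin.val_succ, succAbove_val]
      split_ifs <;> omega
  by_cases h2 : i' = j
  · right; left
    subst h2
    refine ⟨i.castSucc, i'.castSucc, i'.succ, by simp; omega, by simp, Phi_a _ _ _ _ hj,
      Phi_b _ _ _ _ hj, ?_⟩
    apply Phi_eq b a' ρ _ i' i hj (by simp)
    · apply Fin.ext
      simp only [Perm.mul_apply, swap_val, Fin.val_castSucc, Fin.val_succ]
      split_ifs <;> omega
    · intro x
      apply Fin.ext
      simp only [Perm.mul_apply, swap_val, Fin.val_castSucc, Fin.val_succ, succAbove_val]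
      split_ifs <;> omega
  · left
    have n1 : (i : ℕ) ≠ j := fun h => h1 (Fin.ext h)
    have n2 : (i' : ℕ) ≠ j := fun h => h2 (Fin.ext h)
    refine ⟨j.succ.succAbove i, j.succ.succAbove i', ?_, ?_, ?_, ?_, ?_, ?_⟩
    · rw [succAbove_val, succAbove_val]; split_ifs <;> omega
    · rw [Phi_ne _ _ _ _ hj, ← hj]
      intro h; exact h1 (ρ.injective (Fin.succAbove_right_injective h))
    · rw [Phi_ne _ _ _ _ hj]; exact Fin.succAbove_ne _ _
    · rw [Phi_ne _ _ _ _ hj, ← hj]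
      intro h; exact h2 (ρ.injective (Fin.succAbove_right_injective h))
    · rw [Phi_ne _ _ _ _ hj]; exact Fin.succAbove_ne _ _
    · apply Phi_eq b a' ρ _ j j hj
        (swap_apply_of_ne_of_ne (fun h => h1 h.symm) (fun h => h2 h.symm))
      · apply swap_apply_of_ne_of_ne
        · exact (Fin.succAbove_ne _ _).symm
        · exact (Fin.succAbove_ne _ _).symm
      · intro x
        apply Fin.ext
        simp only [swap_val, succAbove_val]
        split_ifs <;> omega

theorem card_fbar {m : ℕ} (b : Fin (m + 1)) (a' : Fin m) :
    Nat.card {σ // Fbar (b.succAbove a') b σ} = m.factorial := by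
  have : Nat.card (Perm (Fin m)) = Nat.card {σ // Fbar (b.succAbove a') b σ} := by
    apply Nat.card_congr
    apply Equiv.ofBijective (fun ρ => ⟨Phi b a' ρ, Phi_fbar b a' ρ⟩)
    constructor
    · intro x y h; exact Phi_inj b a' (congrArg Subtype.val h)
    · rintro ⟨σ, hσ⟩
      obtain ⟨ρ, hρ⟩ := Phi_surj b a' σ hσ
      exact ⟨ρ, Subtype.ext hρ⟩
  rw [← this, Nat.card_eq_fintype_card, Fintype.card_perm, Fintype.card_fin]

theorem bdry_lower {m : ℕ} (b : Fin (m + 1)) (a' : Fin m) (f : Perm (Fin (m + 1)) → Fin (m + 1)) :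
    ∃ B C : ℕ, B = Nat.card {σ // BSet f (b.succAbove a') b σ} ∧ B + C = m.factorial ∧
      B * C ≤ m.factorial *
        (m * (2 * (m - 1) * Nat.card {σ // InBdryB f (b.succAbove a') b σ})) := by
  classical
  let S : Finset (Perm (Fin m)) :=
    Finset.univ.filter fun ρ => BSet f (b.succAbove a') b (Phi b a' ρ)
  have hmemS : ∀ ρ, ρ ∈ S ↔ BSet f (b.succAbove a') b (Phi b a' ρ) := by intro ρ; simp [S]
  refine ⟨S.card, (Sᶜ).card, ?_, ?_, ?_⟩
  · rw [Nat.card_eq_fintype_card, Fintype.card_subtype]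
    apply Finset.card_bij (fun ρ _ => Phi b a' ρ)
    · intro ρ hρ; simpa using (hmemS ρ).1 hρ
    · intro x _ y _ h; exact Phi_inj b a' h
    · intro σ hσ
      simp only [Finset.mem_filter, Finset.mem_univ, true_and] at hσ
      obtain ⟨ρ, rfl⟩ := Phi_surj b a' σ (bset_fbar (Fin.succAbove_ne _ _) hσ)
      exact ⟨ρ, (hmemS ρ).2 hσ, rfl⟩
  · rw [Finset.card_add_card_compl, Fintype.card_perm, Fintype.card_fin]
  · apply isoperim
    intro i i' hi
    unfold cross
    rw [Nat.card_eq_fintype_card, Fintype.card_subtype]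
    apply Finset.card_le_card_of_injOn (fun ρ => Phi b a' ρ)
    · intro ρ hρ
      simp only [Finset.coe_filter, Set.mem_setOf_eq, hmemS] at hρ
      simp only [Finset.coe_filter, Set.mem_setOf_eq, Finset.mem_univ, true_and]
      exact ⟨hρ.1, _, Phi_adj b a' ρ i i' hi, hρ.2⟩
    · intro x _ y _ h; exact Phi_inj b a' h

theorem prob_eq {k : ℕ} (p : Perm (Fin k) → Prop) :
    prob p = (Nat.card {σ // p σ} : ℝ) / (k.factorial : ℝ) := by
  classical
  unfold prob
  rw [Nat.card_eq_fintype_card, Fintype.card_subtype, Fintype.card_perm, Fintype.card_fin]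

end S14

theorem stmt14 (k : ℕ) (hk : 3 ≤ k) (ε : ℝ) (hε0 : 0 < ε) (hε1 : ε ≤ 1)
    (a b : Fin k) (hab : a ≠ b) (f : Equiv.Perm (Fin k) → Fin k)
    (hB : 2 * ε / (k : ℝ) ^ 6 ≤ prob (fun σ : Equiv.Perm (Fin k) => BSet f a b σ))
    (hSm : prob (fun σ : Equiv.Perm (Fin k) => BSet f a b σ ∧ Fbar a b σ) /
          prob (fun σ : Equiv.Perm (Fin k) => Fbar a b σ) ≤ 1 - ε / (4 * (k : ℝ))) :
    ε ^ 2 / (2 * (k : ℝ) ^ 10) ≤ prob (fun σ : Equiv.Perm (Fin k) => InLD f a b σ) ∨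
      ε ^ 2 / (4 * (k : ℝ) ^ 12) ≤ prob (fun σ : Equiv.Perm (Fin k) => IsMPointR1 3 f σ) := by
  obtain ⟨m, rfl⟩ : ∃ m, k = m + 1 := ⟨k - 1, by omega⟩
  obtain ⟨a', rfl⟩ := Fin.exists_succAbove_eq hab
  obtain ⟨B, C, hBdef, hBC, hiso⟩ := S14.bdry_lower b a' f
  have hcount := S14.bdry_count f _ _ hab
  have hcF := S14.card_fbar b a'
  have hBF : (fun σ : Equiv.Perm (Fin (m + 1)) => BSet f (b.succAbove a') b σ ∧
      Fbar (b.succAbove a') b σ) = (fun σ => BSet f (b.succAbove a') b σ) := by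
    funext σ
    exact propext ⟨fun h => h.1, fun h => ⟨h, S14.bset_fbar hab h⟩⟩
  rw [hBF] at hSm
  simp only [S14.prob_eq] at *
  rw [hcF, ← hBdef] at hSm
  rw [← hBdef] at hB
  generalize Nat.card {σ // InBdryB f (b.succAbove a') b σ} = D at *
  generalize Nat.card {σ // InLD f (b.succAbove a') b σ} = L at *
  generalize Nat.card {σ // IsMPointR1 3 f σ} = M at *
  have hm : 2 ≤ m := by omega
  have hn0 : (0 : ℝ) < (m.factorial : ℝ) := by exact_mod_cast m.factorial_pos
  have hNn : ((m + 1).factorial : ℝ) = ((m + 1 : ℕ) : ℝ) * (m.factorial : ℝ) := by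
    exact_mod_cast m.factorial_succ
  have hN0 : (0 : ℝ) < ((m + 1).factorial : ℝ) := by exact_mod_cast (m + 1).factorial_pos
  have hisoR : (B : ℝ) * C ≤ m.factorial * (m * (2 * ((m : ℝ) - 1) * D)) := by
    have : ((m - 1 : ℕ) : ℝ) = (m : ℝ) - 1 := by
      rw [Nat.cast_sub (by omega)]; simp
    rw [← this]; exact_mod_cast hiso
  have hcountR : (D : ℝ) ≤ L + 3 * ((m + 1 : ℕ) : ℝ) ^ 2 * M := by exact_mod_cast hcount
  have hBCR : (B : ℝ) + C = m.factorial := by exact_mod_cast hBC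
  have hkm : (m : ℝ) = ((m + 1 : ℕ) : ℝ) - 1 := by push_cast; ring
  rw [hkm] at hisoR
  have hK3 : (3 : ℝ) ≤ ((m + 1 : ℕ) : ℝ) := by exact_mod_cast hk
  generalize ((m + 1 : ℕ) : ℝ) = K at *
  generalize (m.factorial : ℝ) = n at *
  generalize ((m + 1).factorial : ℝ) = N at *
  have hK0 : 0 < K := by linarith
  rw [div_div_div_cancel_right₀ hN0.ne'] at hSm
  have hC : ε / (4 * K) * n ≤ C := by
    rw [div_le_iff₀ hn0] at hSm
    linarith
  rw [le_div_iff₀ hN0] at hB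
  have hB0 : (0 : ℝ) ≤ B := Nat.cast_nonneg _
  have hD1 : (B : ℝ) * (ε / (4 * K)) ≤ 2 * (K - 1) * (K - 2) * D := by
    have h1 : (B : ℝ) * (ε / (4 * K) * n) ≤ B * C := mul_le_mul_of_nonneg_left hC hB0
    have h2 : ((B : ℝ) * (ε / (4 * K))) * n ≤ (2 * (K - 1) * (K - 2) * D) * n := by
      calc _ = (B : ℝ) * (ε / (4 * K) * n) := by ring
        _ ≤ _ := h1
        _ ≤ _ := hisoR
        _ = _ := by ring
    exact le_of_mul_le_mul_right h2 hn0
  have hD2 : 2 * ε / K ^ 6 * N * (ε / (4 * K)) ≤ 2 * (K - 1) * (K - 2) * D :=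
    (mul_le_mul_of_nonneg_right hB (by positivity)).trans hD1
  by_contra hcon
  push Not at hcon
  obtain ⟨hL, hM⟩ := hcon
  rw [div_lt_iff₀ hN0] at hL hM
  have hDlt : (D : ℝ) < 5 / 4 * (ε ^ 2 * N / K ^ 10) := by
    calc (D : ℝ) ≤ L + 3 * K ^ 2 * M := hcountR
      _ < ε ^ 2 / (2 * K ^ 10) * N + 3 * K ^ 2 * (ε ^ 2 / (4 * K ^ 12) * N) := by
          have : 3 * K ^ 2 * M ≤ 3 * K ^ 2 * (ε ^ 2 / (4 * K ^ 12) * N) :=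
            mul_le_mul_of_nonneg_left hM.le (by positivity)
          linarith
      _ = _ := by field_simp; ring
  have hlhs : 2 * ε / K ^ 6 * N * (ε / (4 * K)) = K ^ 3 / 2 * (ε ^ 2 * N / K ^ 10) := by
    field_simp; ring
  rw [hlhs] at hD2
  have hX : 0 < ε ^ 2 * N / K ^ 10 := by positivity
  generalize ε ^ 2 * N / K ^ 10 = X at *
  have hpos : 0 ≤ 2 * (K - 1) * (K - 2) := by
    apply mul_nonneg <;> linarith
  have h3 : K ^ 3 / 2 * X ≤ 2 * (K - 1) * (K - 2) * (5 / 4 * X) :=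
    hD2.trans (mul_le_mul_of_nonneg_left hDlt.le hpos)
  have h4 : K ^ 3 / 2 ≤ 2 * (K - 1) * (K - 2) * (5 / 4) := by
    apply le_of_mul_le_mul_right _ hX
    linarith
  nlinarith [mul_nonneg hK0.le (sq_nonneg (K - 5 / 2))]
end

section
/- Let k ≥ 3, let a, b, c be distinct alternatives, let f : S_k → [k] be an SCF on one voter, and let 0 < δ ≤ 1. If P^{(a,b,c)}(σ ∈ T(a,b,c)) ≤ 1 − δ, then P^{(a,b,c)}(σ ∈ ∂(T(a,b,c))) ≥ (δ/k^3) · P^{(a,b,c)}(σ ∈ T(a,b,c)). -/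
open Finset

open Classical in
/-- The points of `T` that leave `T` under right multiplication by `τ`. -/
noncomputable def esc {k : ℕ} (T : Finset (Equiv.Perm (Fin k))) (τ : Equiv.Perm (Fin k)) : ℕ :=
  (T.filter (fun σ => σ * τ ∉ T)).card

lemma esc_mul {k : ℕ} (T : Finset (Equiv.Perm (Fin k))) (τ τ' : Equiv.Perm (Fin k)) :
    esc T (τ * τ') ≤ esc T τ + esc T τ' := by
  classical
  unfold esc
  have h1 : T.filter (fun σ => σ * (τ * τ') ∉ T) ⊆
      T.filter (fun σ => σ * τ ∉ T) ∪
        (T.filter (fun σ => σ * τ' ∉ T)).image (fun σ => σ * τ⁻¹) := by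
    intro σ hσ
    simp only [mem_filter, mem_union, mem_image] at hσ ⊢
    by_cases h : σ * τ ∈ T
    · right
      refine ⟨σ * τ, ⟨h, ?_⟩, by group⟩
      rw [mul_assoc]; exact hσ.2
    · left; exact ⟨hσ.1, h⟩
  exact (card_le_card h1).trans ((card_union_le _ _).trans (Nat.add_le_add_left card_image_le _))

lemma esc_one {k : ℕ} (T : Finset (Equiv.Perm (Fin k))) : esc T 1 = 0 := by
  classical
  simp [esc]

lemma esc_swap {k : ℕ} (T : Finset (Equiv.Perm (Fin k))) (D : ℕ)
    (hD : ∀ p q : Fin k, 3 ≤ (p : ℕ) → (p : ℕ) + 1 = q → esc T (Equiv.swap p q) ≤ D) :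
    ∀ (d : ℕ) (p q : Fin k), 3 ≤ (p : ℕ) → (p : ℕ) + d = q →
      esc T (Equiv.swap p q) ≤ 2 * d * D := by
  intro d
  induction d with
  | zero =>
    intro p q hp hq
    have : p = q := Fin.ext (by omega)
    subst this
    rw [Equiv.swap_self]
    exact (esc_one T).le.trans (Nat.zero_le _)
  | succ d ih =>
    intro p q hp hq
    rcases Nat.eq_zero_or_pos d with rfl | hd
    · have := hD p q hp (by omega)
      nlinarith
    · have hlt : (p : ℕ) + d < k := by have := q.2; omega
      let r : Fin k := ⟨(p : ℕ) + d, hlt⟩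
      have hpr : p ≠ r := fun h => by have := congrArg Fin.val h; simp [r] at this; omega
      have hpq : p ≠ q := fun h => by have := congrArg Fin.val h; omega
      have e : Equiv.swap p q = Equiv.swap r q * Equiv.swap p r * Equiv.swap r q := by
        rw [Equiv.swap_mul_swap_mul_swap hpr hpq, Equiv.swap_comm]
      have h1 := ih p r hp rfl
      have h2 := hD r q (by simp only [r]; omega) (by simp only [r]; omega)
      have h3 := esc_mul T (Equiv.swap r q * Equiv.swap p r) (Equiv.swap r q)
      have h4 := esc_mul T (Equiv.swap r q) (Equiv.swap p r)
      rw [e]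
      nlinarith

lemma esc_le {k : ℕ} (T : Finset (Equiv.Perm (Fin k))) (D : ℕ)
    (hD : ∀ p q : Fin k, 3 ≤ (p : ℕ) → (p : ℕ) + 1 = q → esc T (Equiv.swap p q) ≤ D) :
    ∀ (n : ℕ) (τ : Equiv.Perm (Fin k)), (∀ x : Fin k, (x : ℕ) < 3 → τ x = x) →
      τ.support.card ≤ n → esc T τ ≤ n * (2 * k * D) := by
  have hsw : ∀ p q : Fin k, 3 ≤ (p : ℕ) → 3 ≤ (q : ℕ) →
      esc T (Equiv.swap p q) ≤ 2 * k * D := by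
    intro p q hp hq
    rcases le_total (p : ℕ) (q : ℕ) with h | h
    · refine (esc_swap T D hD (q - p) p q hp (by omega)).trans ?_
      gcongr
      have := q.2; omega
    · rw [Equiv.swap_comm]
      refine (esc_swap T D hD (p - q) q p hq (by omega)).trans ?_
      gcongr
      have := p.2; omega
  intro n
  induction n with
  | zero =>
    intro τ _ h
    have : τ = 1 := by
      rw [← Equiv.Perm.support_eq_empty_iff, ← card_eq_zero]; omega
    rw [this, esc_one]; exact Nat.zero_le _
  | succ n ih =>
    intro τ hτ h
    by_cases h1 : τ = 1
    · rw [h1, esc_one]; exact Nat.zero_le _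
    · obtain ⟨x, hx⟩ : ∃ x, τ x ≠ x := by
        by_contra hc; push Not at hc; exact h1 (Equiv.ext hc)
      have hx3 : 3 ≤ (x : ℕ) := by
        by_contra hc; exact hx (hτ x (by omega))
      have hy3 : 3 ≤ (τ x : ℕ) := by
        by_contra hc
        exact hx (τ.injective (hτ (τ x) (by omega)))
      have hs := Equiv.Perm.card_support_swap_mul hx
      have e : τ = Equiv.swap x (τ x) * (Equiv.swap x (τ x) * τ) := by
        rw [← mul_assoc, Equiv.swap_mul_self, one_mul]
      have h2 := ih (Equiv.swap x (τ x) * τ) (by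
        intro z hz
        rw [Equiv.Perm.mul_apply, hτ z hz]
        apply Equiv.swap_apply_of_ne_of_ne
        · rintro rfl; omega
        · rintro rfl; omega) (by omega)
      have h3 := esc_mul T (Equiv.swap x (τ x)) (Equiv.swap x (τ x) * τ)
      rw [← e] at h3
      have h4 := hsw x (τ x) hx3 hy3
      rw [Nat.succ_mul]
      omega

lemma vset_apply {k : ℕ} {a b c : Fin k} {σ : Equiv.Perm (Fin k)} (h : VSet a b c σ)
    (x : Fin k) : ((x : ℕ) = 0 → σ x = a) ∧ ((x : ℕ) = 1 → σ x = b) ∧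
      ((x : ℕ) = 2 → σ x = c) := by
  obtain ⟨p, q, r, hp, hq, hr, ha, hb, hc⟩ := h
  refine ⟨fun hx => ?_, fun hx => ?_, fun hx => ?_⟩
  · rw [Fin.ext (hx.trans hp.symm), ha]
  · rw [Fin.ext (hx.trans hq.symm), hb]
  · rw [Fin.ext (hx.trans hr.symm), hc]

lemma vset_mul {k : ℕ} {a b c : Fin k} {σ τ : Equiv.Perm (Fin k)} (h : VSet a b c σ)
    (hτ : ∀ x : Fin k, (x : ℕ) < 3 → τ x = x) : VSet a b c (σ * τ) := by
  obtain ⟨p, q, r, hp, hq, hr, ha, hb, hc⟩ := h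
  refine ⟨p, q, r, hp, hq, hr, ?_, ?_, ?_⟩ <;>
    rw [Equiv.Perm.mul_apply, hτ _ (by omega)] <;> assumption

lemma vset_inv_mul {k : ℕ} {a b c : Fin k} {σ π : Equiv.Perm (Fin k)} (h : VSet a b c σ)
    (h' : VSet a b c π) (x : Fin k) (hx : (x : ℕ) < 3) : (σ⁻¹ * π) x = x := by
  rw [Equiv.Perm.mul_apply, Equiv.Perm.inv_eq_iff_eq]
  have h1 := vset_apply h x
  have h2 := vset_apply h' x
  have h3 : (x : ℕ) = 0 ∨ (x : ℕ) = 1 ∨ (x : ℕ) = 2 := by omega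
  rcases h3 with h3 | h3 | h3
  · rw [h1.1 h3, h2.1 h3]
  · rw [h1.2.1 h3, h2.2.1 h3]
  · rw [h1.2.2 h3, h2.2.2 h3]

open Classical in
lemma count_bound {k : ℕ} (a b c : Fin k) (f : Equiv.Perm (Fin k) → Fin k)
    (T V B : Finset (Equiv.Perm (Fin k)))
    (hT : T = univ.filter (fun σ => TSet f a b c σ))
    (hV : V = univ.filter (fun σ => VSet a b c σ))
    (hB : B = univ.filter (fun σ => InBdryT f a b c σ)) :
    T.card * (V \ T).card ≤ V.card * (k * (2 * k * B.card)) := by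
  have mT : ∀ σ, σ ∈ T ↔ TSet f a b c σ := by simp [hT]
  have mV : ∀ σ, σ ∈ V ↔ VSet a b c σ := by simp [hV]
  have mB : ∀ σ, σ ∈ B ↔ InBdryT f a b c σ := by simp [hB]
  rcases T.eq_empty_or_nonempty with h0 | ⟨σ₀, hσ₀⟩
  · simp [h0]
  have hv0 := ((mT σ₀).1 hσ₀).1
  have hD : ∀ p q : Fin k, 3 ≤ (p : ℕ) → (p : ℕ) + 1 = q →
      esc T (Equiv.swap p q) ≤ B.card := by
    intro p q hp hq
    apply card_le_card
    intro σ hσ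
    rw [mem_filter, mT, mT] at hσ
    rw [mB]
    refine ⟨hσ.1, σ * Equiv.swap p q, ⟨hσ.1.1, ?_, ?_, p, q, hq, rfl⟩, hσ.2⟩
    · apply vset_mul hσ.1.1
      intro x hx
      apply Equiv.swap_apply_of_ne_of_ne
      · rintro rfl; omega
      · rintro rfl; omega
    · intro he
      rw [← he] at hσ
      exact hσ.2 hσ.1
  rw [← card_product]
  refine card_le_mul_card_image_of_maps_to
    (f := fun x : Equiv.Perm (Fin k) × Equiv.Perm (Fin k) => σ₀ * (x.1⁻¹ * x.2))
    (t := V) ?_ _ ?_ |>.trans (by rw [mul_comm])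
  · intro x hx
    rw [mem_product, mT, mem_sdiff, mV] at hx
    exact (mV _).2 (vset_mul hv0 (vset_inv_mul hx.1.1 hx.2.1))
  · intro ρ hρ
    have key := esc_le T B.card hD k (σ₀⁻¹ * ρ) (vset_inv_mul hv0 ((mV _).1 hρ))
      ((card_le_univ _).trans (by simp))
    refine le_trans ?_ key
    apply card_le_card_of_injOn (fun x => x.1)
    · intro x hx
      simp only [coe_filter, mem_product, mem_sdiff, Set.mem_ofPred_eq] at hx ⊢
      refine ⟨hx.1.1, ?_⟩
      rw [← hx.2]
      have : x.1 * (σ₀⁻¹ * (σ₀ * (x.1⁻¹ * x.2))) = x.2 := by group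
      rw [this]; exact hx.1.2.2
    · intro x hx y hy hxy
      simp only [coe_filter, Set.mem_ofPred_eq] at hx hy
      have h := hx.2.trans hy.2.symm
      simp only at hxy
      rw [hxy] at h
      exact Prod.ext hxy (mul_left_cancel (mul_left_cancel h))

theorem stmt15 (k : ℕ) (hk : 3 ≤ k) (a b c : Fin k)
    (hab : a ≠ b) (hac : a ≠ c) (hbc : b ≠ c)
    (f : Equiv.Perm (Fin k) → Fin k) (δ : ℝ) (hδ0 : 0 < δ) (hδ1 : δ ≤ 1)
    (h : prob (fun σ : Equiv.Perm (Fin k) => TSet f a b c σ) /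
          prob (fun σ : Equiv.Perm (Fin k) => VSet a b c σ) ≤ 1 - δ) :
    (δ / (k : ℝ) ^ 3) *
        (prob (fun σ : Equiv.Perm (Fin k) => TSet f a b c σ) /
          prob (fun σ : Equiv.Perm (Fin k) => VSet a b c σ)) ≤
      prob (fun σ : Equiv.Perm (Fin k) => InBdryT f a b c σ) /
        prob (fun σ : Equiv.Perm (Fin k) => VSet a b c σ) := by
  classical
  set T := univ.filter (fun σ : Equiv.Perm (Fin k) => TSet f a b c σ) with hT
  set V := univ.filter (fun σ : Equiv.Perm (Fin k) => VSet a b c σ) with hV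
  set B := univ.filter (fun σ : Equiv.Perm (Fin k) => InBdryT f a b c σ) with hB
  have key := count_bound a b c f T V B (by rw [hT]) (by rw [hV]) (by rw [hB])
  have pT : prob (fun σ : Equiv.Perm (Fin k) => TSet f a b c σ) =
    (T.card : ℝ) / (Fintype.card (Equiv.Perm (Fin k)) : ℝ) := by
      unfold prob; rw [hT]
  have pV : prob (fun σ : Equiv.Perm (Fin k) => VSet a b c σ) =
    (V.card : ℝ) / (Fintype.card (Equiv.Perm (Fin k)) : ℝ) := by
      unfold prob; rw [hV]
  have pB : prob (fun σ : Equiv.Perm (Fin k) => InBdryT f a b c σ) =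
    (B.card : ℝ) / (Fintype.card (Equiv.Perm (Fin k)) : ℝ) := by
      unfold prob; rw [hB]
  have hN : (Fintype.card (Equiv.Perm (Fin k)) : ℝ) ≠ 0 := by
    exact_mod_cast Fintype.card_ne_zero
  rw [pT, pV, div_div_div_cancel_right₀ hN] at h
  rw [pT, pV, pB, div_div_div_cancel_right₀ hN, div_div_div_cancel_right₀ hN]
  have hsub : T ⊆ V := by
    intro σ hσ
    rw [hT, mem_filter] at hσ
    rw [hV, mem_filter]
    exact ⟨hσ.1, hσ.2.1⟩
  have hk3 : (3 : ℝ) ≤ k := by exact_mod_cast hk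
  rcases Nat.eq_zero_or_pos V.card with h0 | hpos
  · simp [h0]
  have hv : (0 : ℝ) < V.card := by exact_mod_cast hpos
  have hs : (T.card : ℝ) + ((V \ T).card : ℝ) = V.card := by
    rw [add_comm]; exact_mod_cast card_sdiff_add_card_eq_card hsub
  have key' : (T.card : ℝ) * ((V \ T).card : ℝ) ≤ V.card * (k * (2 * k * B.card)) := by
    exact_mod_cast key
  rw [div_le_iff₀ hv] at h
  have h1 : δ * V.card ≤ ((V \ T).card : ℝ) := by linarith
  have h2 : (T.card : ℝ) * (δ * V.card) ≤ V.card * (k * (2 * k * B.card)) :=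
    (mul_le_mul_of_nonneg_left h1 (Nat.cast_nonneg _)).trans key'
  have h3 : δ * (T.card : ℝ) ≤ k * (2 * k * B.card) := by
    apply le_of_mul_le_mul_left _ hv
    linarith
  have h4 : (k : ℝ) * (2 * k * B.card) ≤ B.card * (k : ℝ) ^ 3 := by
    have : 0 ≤ (k : ℝ) ^ 2 * B.card := by positivity
    nlinarith
  rw [← mul_div_assoc, div_mul_eq_mul_div]
  gcongr
  rw [div_le_iff₀ (by positivity)]
  exact h3.trans h4
end

section
/- Let k ≥ 3, let a, b, c be distinct alternatives, and let f : S_k → [k] be an SCF on one voter. If σ ∈ ∂(T(a,b,c)), then there exists a 2-manipulation point σ̂ ∈ M_2(f) obtained from σ by transposing the alternatives in one pair of adjacent positions, neither of which holds a, b, or c, and then rearranging the order of a, b, c within the top three positions. -/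
open Finset

theorem stmt16 (k : ℕ) (hk : 3 ≤ k) (a b c : Fin k)
    (hab : a ≠ b) (hac : a ≠ c) (hbc : b ≠ c)
    (f : Equiv.Perm (Fin k) → Fin k) (σ : Equiv.Perm (Fin k))
    (hσ : InBdryT f a b c σ) :
    ∃ p q : Fin k, (p : ℕ) + 1 = (q : ℕ) ∧
      σ p ≠ a ∧ σ p ≠ b ∧ σ p ≠ c ∧ σ q ≠ a ∧ σ q ≠ b ∧ σ q ≠ c ∧
      ∃ σh : Equiv.Perm (Fin k), IsMPointR1 2 f σh ∧
        ∀ x : Fin k, 3 ≤ (x : ℕ) → σh x = (σ * Equiv.swap p q) x := by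
  obtain ⟨⟨hV, -, hL⟩, π, ⟨-, hVπ, -, p, q, hpq, hπ⟩, hT⟩ := hσ
  obtain ⟨p0, p1, p2, h0, h1, h2, ha, hb, hc⟩ := hV
  obtain ⟨p0', p1', p2', h0', h1', h2', ha', hb', hc'⟩ := id hVπ
  obtain rfl : p0' = p0 := Fin.ext (by omega)
  obtain rfl : p1' = p1 := Fin.ext (by omega)
  obtain rfl : p2' = p2 := Fin.ext (by omega)
  have hpq' : p ≠ q := by rintro rfl; omega
  have key : ∀ x, π x = σ x → p ≠ x ∧ q ≠ x := by
    intro x hx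
    rw [hπ, Equiv.Perm.mul_apply] at hx
    have := σ.injective hx
    constructor
    · rintro rfl
      rw [Equiv.swap_apply_left] at this
      exact hpq' this.symm
    · rintro rfl
      rw [Equiv.swap_apply_right] at this
      exact hpq' this
  obtain ⟨k0, l0⟩ := key p0' (by rw [ha, ha'])
  obtain ⟨k1, l1⟩ := key p1' (by rw [hb, hb'])
  obtain ⟨k2, l2⟩ := key p2' (by rw [hc, hc'])
  refine ⟨p, q, hpq, ?_, ?_, ?_, ?_, ?_, ?_, ?_⟩
  · rw [← ha]; exact fun h => k0 (σ.injective h)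
  · rw [← hb]; exact fun h => k1 (σ.injective h)
  · rw [← hc]; exact fun h => k2 (σ.injective h)
  · rw [← ha]; exact fun h => l0 (σ.injective h)
  · rw [← hb]; exact fun h => l1 (σ.injective h)
  · rw [← hc]; exact fun h => l2 (σ.injective h)
  have hcard : ({a, b, c} : Finset (Fin k)).card = 3 := Finset.card_eq_three.2 ⟨a, b, c, hab, hac, hbc, rfl⟩
  have hmem : ∀ x : Fin k, π x ∈ ({a, b, c} : Finset (Fin k)) ↔ (x : ℕ) < 3 := by
    intro x
    simp only [Finset.mem_insert, Finset.mem_singleton]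
    rw [← ha', ← hb', ← hc']
    simp only [π.injective.eq_iff, Fin.ext_iff]
    omega
  have hND : ∃ τ : Equiv.Perm (Fin k), (∀ x, π x ∉ ({a, b, c} : Finset (Fin k)) → τ x = π x) ∧
      ¬ (f τ ∈ ({a, b, c} : Finset (Fin k)) ∧
        ∀ d ∈ ({a, b, c} : Finset (Fin k)), d ≠ f τ → Above τ (f τ) d) := by
    by_contra! hcon
    refine hT ⟨hVπ, ⟨0, fun x => ?_⟩, fun τ hτ => hcon τ hτ⟩
    rw [hmem, hcard]; omega
  obtain ⟨τ, hτ, hnot⟩ := hND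
  have hz : τ p0' ∈ ({a, b, c} : Finset (Fin k)) := by
    by_contra hz
    obtain ⟨y, hy⟩ := π.surjective (τ p0')
    have h3 : τ y = τ p0' := by rw [← hy]; exact hτ y (by rwa [hy])
    have h4 := τ.injective h3
    subst h4
    rw [← hy, hmem] at hz
    omega
  -- the top element is above everything else
  have top : ∀ d, d ≠ τ p0' → Above τ (τ p0') d := by
    intro d hd
    unfold Above
    rw [Equiv.symm_apply_apply, Fin.lt_def]
    have : τ.symm d ≠ p0' := fun h => hd (by rw [← h, Equiv.apply_symm_apply])
    rw [Ne, Fin.ext_iff] at this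
    omega
  have hne : f τ ≠ τ p0' := by
    intro h
    apply hnot
    rw [h]
    exact ⟨hz, fun d _ hd => top d hd⟩
  have hρ := hL (τ * Equiv.swap p q) (by
    intro x hx
    have e : π (Equiv.swap p q x) = σ x := by
      rw [hπ, Equiv.Perm.mul_apply, Equiv.swap_apply_self]
    rw [Equiv.Perm.mul_apply, hτ _ (by rwa [e]), e])
  have hfρ : f (τ * Equiv.swap p q) = τ p0' := by
    by_contra h
    have h5 := hρ.2 _ hz (Ne.symm h)
    unfold Above at h5
    have h6 : (τ * Equiv.swap p q).symm (τ p0') = p0' := by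
      rw [Equiv.symm_apply_eq, Equiv.Perm.mul_apply, Equiv.swap_apply_of_ne_of_ne k0.symm l0.symm]
    rw [h6, Fin.lt_def] at h5
    omega
  refine ⟨τ, ⟨τ * Equiv.swap p q, ?_, ?_, (p : ℕ), ?_⟩, ?_⟩
  · intro h
    rw [← h] at hfρ
    exact hne hfρ
  · rw [hfρ]; exact top _ hne
  · intro x hx
    have hxp : x ≠ p := by rintro rfl; omega
    have hxq : x ≠ q := by rintro rfl; omega
    rw [Equiv.Perm.mul_apply, Equiv.swap_apply_of_ne_of_ne hxp hxq]
  · intro x hx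
    rw [← hπ]
    exact hτ x (by rw [hmem]; omega)
end

section
/- Let k ≥ 3, 0 < ε ≤ 1, let a ≠ b be alternatives, and let f : S_k → [k] be an SCF on one voter. Suppose that Σ_{c ∉ {a,b}} P(σ ∈ LD^{{a,b,c}} and {σ(1),σ(2),σ(3)} = {a,b,c}) ≥ ε^2/(4k^11), and that for every c ∉ {a,b} one has P^{(a,b,c)}(σ ∈ T(a,b,c)) ≤ 1 − ε/(100k). Then P(σ ∈ M_2(f)) ≥ ε^3/(10^5 k^16). -/
open Finset

theorem s17_prob_eq {Ω : Type*} [Fintype Ω] (p : Ω → Prop) [DecidablePred p] :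
    prob p = ((Finset.univ.filter p).card : ℝ) / (Fintype.card Ω : ℝ) := by
  unfold prob
  congr!

theorem s17_memiff {k : ℕ} (H : Finset (Fin k)) (σ τ : Equiv.Perm (Fin k))
    (h : ∀ x, σ x ∉ H → τ x = σ x) (x : Fin k) : τ x ∈ H ↔ σ x ∈ H := by
  constructor
  · intro h1
    by_contra h2
    rw [h x h2] at h1
    exact h2 h1
  · intro h1
    by_contra h2
    have h3 : τ (σ.symm (τ x)) = σ (σ.symm (τ x)) := h _ (by simpa using h2)
    rw [Equiv.apply_symm_apply] at h3
    have h4 := τ.injective h3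
    rw [Equiv.symm_apply_eq] at h4
    rw [h4] at h2
    exact h2 h1

theorem s17_transfer {k : ℕ} (f : Equiv.Perm (Fin k) → Fin k) (H : Finset (Fin k))
    (σ τ : Equiv.Perm (Fin k)) (h : ∀ x, σ x ∉ H → τ x = σ x)
    (hσ : IsLocalDict f H σ) : IsLocalDict f H τ := by
  obtain ⟨⟨l, hl⟩, h2⟩ := hσ
  refine ⟨⟨l, fun x => by rw [s17_memiff H σ τ h x, hl x]⟩, fun σ' h' => h2 σ' ?_⟩
  intro x hx
  have : τ x ∉ H := by rw [s17_memiff H σ τ h x]; exact hx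
  rw [h' x this, h x hx]

/-- In a ranking in `V_{(a,b,c)}`, the set `{a,b,c}` is exactly positions `< 3`. -/
theorem s17_vmem {k : ℕ} {a b c : Fin k} {σ : Equiv.Perm (Fin k)} (hV : VSet a b c σ)
    (x : Fin k) : σ x ∈ ({a, b, c} : Finset (Fin k)) ↔ (x : ℕ) < 3 := by
  obtain ⟨p, q, r, hp, hq, hr, rfl, rfl, rfl⟩ := hV
  simp only [Finset.mem_insert, Finset.mem_singleton, σ.injective.eq_iff, Fin.ext_iff]
  omega

theorem s17_vmul {k : ℕ} {a b c : Fin k} {σ g : Equiv.Perm (Fin k)} (hV : VSet a b c σ)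
    (hg : ∀ x : Fin k, (x : ℕ) < 3 → g x = x) : VSet a b c (σ * g) := by
  obtain ⟨p, q, r, hp, hq, hr, h1, h2, h3⟩ := hV
  refine ⟨p, q, r, hp, hq, hr, ?_, ?_, ?_⟩
  · rw [Equiv.Perm.mul_apply, hg p (by omega), h1]
  · rw [Equiv.Perm.mul_apply, hg q (by omega), h2]
  · rw [Equiv.Perm.mul_apply, hg r (by omega), h3]

theorem s17_swapfix {k : ℕ} (p q : Fin k) (hp : 3 ≤ (p : ℕ)) (hq : 3 ≤ (q : ℕ))
    (x : Fin k) (hx : (x : ℕ) < 3) : Equiv.swap p q x = x := by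
  apply Equiv.swap_apply_of_ne_of_ne <;> (intro h; subst h; omega)

theorem s17_swapge {k : ℕ} (p q : Fin k) (hp : 3 ≤ (p : ℕ)) (hq : 3 ≤ (q : ℕ))
    (x : Fin k) (hx : 3 ≤ (x : ℕ)) : 3 ≤ (Equiv.swap p q x : ℕ) := by
  rw [Equiv.swap_apply_def]
  split_ifs <;> assumption

/-- Outer boundary of `T(a,b,c)`. -/
def s17Out {k : ℕ} (f : Equiv.Perm (Fin k) → Fin k) (a b c : Fin k)
    (π : Equiv.Perm (Fin k)) : Prop :=
  VSet a b c π ∧ ¬ TSet f a b c π ∧ ∃ p q : Fin k, 3 ≤ (p : ℕ) ∧ (p : ℕ) + 1 = (q : ℕ) ∧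
    TSet f a b c (π * Equiv.swap p q)

theorem s17_manip {k : ℕ} (f : Equiv.Perm (Fin k) → Fin k) {a b c : Fin k}
    (hab : a ≠ b) (hca : c ≠ a) (hcb : c ≠ b)
    (π : Equiv.Perm (Fin k)) (h : s17Out f a b c π) :
    ∃ π' : Equiv.Perm (Fin k), IsMPointR1 2 f π' ∧ ∀ x : Fin k, 3 ≤ (x : ℕ) → π' x = π x := by
  obtain ⟨hV, hnT, p, q, hp, hpq, hVσ, -, hLD⟩ := h
  have hcard : ({a, b, c} : Finset (Fin k)).card = 3 := by
    rw [Finset.card_eq_three]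
    exact ⟨a, b, c, hab, hca.symm, hcb.symm, rfl⟩
  have hmem := s17_vmem hV
  have hex : ∃ π' : Equiv.Perm (Fin k), (∀ x, π x ∉ ({a, b, c} : Finset (Fin k)) → π' x = π x) ∧
      ¬ (f π' ∈ ({a, b, c} : Finset (Fin k)) ∧
        ∀ d ∈ ({a, b, c} : Finset (Fin k)), d ≠ f π' → Above π' (f π') d) := by
    by_contra hcon
    push Not at hcon
    refine hnT ⟨hV, ⟨0, fun x => ?_⟩, fun σ' hσ' => ?_⟩
    · rw [hmem, hcard]; omega
    · have := hcon σ' hσ'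
      exact this
  obtain ⟨π', hπ', hbad⟩ := hex
  have hge : ∀ x : Fin k, 3 ≤ (x : ℕ) → π' x = π x := fun x hx =>
    hπ' x (by rw [hmem]; omega)
  refine ⟨π', ?_, hge⟩
  have hq : 3 ≤ (q : ℕ) := by omega
  have hσ' := hLD (π' * Equiv.swap p q) (by
    intro x hx
    rw [s17_vmem hVσ] at hx
    rw [Equiv.Perm.mul_apply, Equiv.Perm.mul_apply]
    exact hge _ (s17_swapge p q hp hq x (by omega)))
  have hk0 : 0 < k := by have := p.2; omega
  let z : Fin k := ⟨0, hk0⟩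
  have hz : (π' * Equiv.swap p q) z = π' z := by
    rw [Equiv.Perm.mul_apply, s17_swapfix p q hp hq z (by simp [z])]
  have hzH : π' z ∈ ({a, b, c} : Finset (Fin k)) := by
    rw [s17_memiff _ π π' hπ' z, hmem]; simp [z]
  have hfz : f (π' * Equiv.swap p q) = π' z := by
    by_contra hne
    have h3 := hσ'.2 (π' z) hzH (fun h => hne h.symm)
    unfold Above at h3
    rw [← hz, Equiv.symm_apply_apply] at h3
    have h4 := Fin.lt_def.mp h3
    simp [z] at h4
  have hfπ : f π' ≠ π' z := by
    intro hcon
    apply hbad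
    rw [hcon]
    refine ⟨hzH, fun d _ hd => ?_⟩
    unfold Above
    rw [Equiv.symm_apply_apply, Fin.lt_def]
    have : π'.symm d ≠ z := by
      intro h; apply hd; rw [← h, Equiv.apply_symm_apply]
    have h5 : (π'.symm d : ℕ) ≠ 0 := fun h => this (Fin.ext h)
    simp [z]; omega
  refine ⟨π' * Equiv.swap p q, ?_, ?_, ?_⟩
  · intro h
    apply hfπ
    rw [← hfz, ← h]
  · rw [hfz]
    unfold Above
    rw [Equiv.symm_apply_apply, Fin.lt_def]
    have : π'.symm (f π') ≠ z := by
      intro h; apply hfπ; rw [← h, Equiv.apply_symm_apply]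
    have h5 : (π'.symm (f π') : ℕ) ≠ 0 := fun h => this (Fin.ext h)
    simp [z]; omega
  · refine ⟨p, fun x hx => ?_⟩
    rw [Equiv.Perm.mul_apply, Equiv.swap_apply_of_ne_of_ne]
    · intro h; subst h; omega
    · intro h; subst h; omega

open Classical in
/-- Number of exits from `T` under right multiplication by `g`. -/
noncomputable def s17N {k : ℕ} (T : Equiv.Perm (Fin k) → Prop) (g : Equiv.Perm (Fin k)) : ℕ :=
  (Finset.univ.filter (fun x => T x ∧ ¬ T (x * g))).card

theorem s17N_one {k : ℕ} (T : Equiv.Perm (Fin k) → Prop) : s17N T 1 = 0 := by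
  classical
  unfold s17N
  rw [Finset.card_eq_zero, Finset.filter_eq_empty_iff]
  intro x _ h
  rw [mul_one] at h
  exact h.2 h.1

theorem s17N_mul {k : ℕ} (T : Equiv.Perm (Fin k) → Prop) (g h : Equiv.Perm (Fin k)) :
    s17N T (g * h) ≤ s17N T g + s17N T h := by
  classical
  unfold s17N
  have h1 : (Finset.univ.filter (fun x => T x ∧ ¬ T (x * (g * h)))) ⊆
      (Finset.univ.filter (fun x => T x ∧ ¬ T (x * g))) ∪
      ((Finset.univ.filter (fun x => T x ∧ ¬ T (x * h))).image (fun y => y * g⁻¹)) := by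
    intro x hx
    rw [Finset.mem_filter] at hx
    rw [Finset.mem_union, Finset.mem_filter, Finset.mem_image]
    by_cases hg : T (x * g)
    · right
      refine ⟨x * g, ?_, by group⟩
      rw [Finset.mem_filter]
      refine ⟨Finset.mem_univ _, hg, ?_⟩
      rw [mul_assoc]
      exact hx.2.2
    · left
      exact ⟨Finset.mem_univ _, hx.2.1, hg⟩
  refine (Finset.card_le_card h1).trans ((Finset.card_union_le _ _).trans ?_)
  exact Nat.add_le_add_left Finset.card_image_le _

theorem s17N_swap {k : ℕ} (T : Equiv.Perm (Fin k) → Prop) (B : ℕ)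
    (hB : ∀ p q : Fin k, 3 ≤ (p : ℕ) → (p : ℕ) + 1 = (q : ℕ) → s17N T (Equiv.swap p q) ≤ B)
    (d : ℕ) : ∀ p q : Fin k, 3 ≤ (p : ℕ) → (p : ℕ) + d = (q : ℕ) →
      s17N T (Equiv.swap p q) ≤ 2 * d * B := by
  induction d with
  | zero =>
    intro p q _ h
    have : p = q := Fin.ext (by omega)
    subst this
    rw [Equiv.swap_self]
    have := s17N_one T
    rw [Equiv.Perm.one_def] at this
    omega
  | succ d ih =>
    intro p q hp h
    rcases Nat.eq_zero_or_pos d with rfl | hd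
    · have := hB p q hp (by omega)
      omega
    have hr : (p : ℕ) + d < k := by have := q.2; omega
    let r : Fin k := ⟨p + d, hr⟩
    have hpr : p ≠ r := by intro h; have := congrArg Fin.val h; simp [r] at this; omega
    have hpq : p ≠ q := by intro h; have := congrArg Fin.val h; omega
    have hs : Equiv.swap p q = Equiv.swap r q * Equiv.swap p r * Equiv.swap r q := by
      rw [Equiv.swap_mul_swap_mul_swap]
      · exact Equiv.swap_comm p q
      all_goals first | exact hpr.symm | exact hpq.symm | exact hpr | exact hpq
    rw [hs]
    have e1 := s17N_mul T (Equiv.swap r q * Equiv.swap p r) (Equiv.swap r q)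
    have e2 := s17N_mul T (Equiv.swap r q) (Equiv.swap p r)
    have e3 := hB r q (by simp [r]; omega) (by simp [r]; omega)
    have e4 := ih p r hp (by simp [r])
    nlinarith

theorem s17N_all {k : ℕ} (T : Equiv.Perm (Fin k) → Prop) (B : ℕ)
    (hB : ∀ p q : Fin k, 3 ≤ (p : ℕ) → (p : ℕ) + 1 = (q : ℕ) → s17N T (Equiv.swap p q) ≤ B)
    (n : ℕ) : ∀ g : Equiv.Perm (Fin k), (∀ x : Fin k, (x : ℕ) < 3 ∨ n ≤ (x : ℕ) → g x = x) →
      s17N T g ≤ n * (2 * k * B) := by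
  induction n with
  | zero =>
    intro g hg
    have : g = 1 := by ext x; rw [hg x (Or.inr (Nat.zero_le _))]; rfl
    rw [this, s17N_one]; omega
  | succ n ih =>
    intro g hg
    by_cases hn : n < 3 ∨ k ≤ n
    · refine (ih g fun x hx => hg x ?_).trans (Nat.mul_le_mul_right _ (by omega))
      have := x.2
      omega
    · push Not at hn
      let m : Fin k := ⟨n, hn.2⟩
      have hgm : 3 ≤ (g m : ℕ) := by
        by_contra hlt
        have h1 := hg (g m) (Or.inl (by omega))
        have h2 := g.injective h1
        rw [h2] at hlt
        simp [m] at hlt; omega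
      have hgm' : (g m : ℕ) ≤ n := by
        by_contra hlt
        have h1 := hg (g m) (Or.inr (by omega))
        have h2 := g.injective h1
        rw [h2] at hlt
        simp [m] at hlt
      have hfac : g = Equiv.swap (g m) m * (Equiv.swap (g m) m * g) := by
        rw [Equiv.swap_mul_self_mul]
      have e1 := s17N_swap T B hB (n - (g m : ℕ)) (g m) m hgm
        (by change (g m : ℕ) + (n - (g m : ℕ)) = n; omega)
      have e2 := ih (Equiv.swap (g m) m * g) (by
        intro x hx
        rw [Equiv.Perm.mul_apply]
        by_cases hxm : x = m
        · subst hxm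
          exact Equiv.swap_apply_left _ _
        · have hxn : (x : ℕ) ≠ n := fun h => hxm (Fin.ext h)
          have hgx := hg x (by omega)
          rw [hgx]
          apply Equiv.swap_apply_of_ne_of_ne
          · intro h
            apply hxm
            apply g.injective
            rw [hgx, ← h]
          · exact hxm)
      have e3 := s17N_mul T (Equiv.swap (g m) m) (Equiv.swap (g m) m * g)
      rw [← hfac] at e3
      have e4 : 2 * (n - (g m : ℕ)) * B ≤ 2 * k * B := by
        apply Nat.mul_le_mul_right
        omega
      calc s17N T g ≤ _ := e3
        _ ≤ 2 * k * B + n * (2 * k * B) := by omega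
        _ = (n + 1) * (2 * k * B) := by ring

open Classical in
/-- Isoperimetric inequality. -/
theorem s17_iso {k : ℕ} (f : Equiv.Perm (Fin k) → Fin k) (a b c : Fin k) :
    (univ.filter (TSet f a b c)).card *
      (univ.filter (fun σ => VSet a b c σ ∧ ¬ TSet f a b c σ)).card ≤
    (univ.filter (VSet a b c)).card *
      (2 * k ^ 2 * (univ.filter (s17Out f a b c)).card) := by
  set B := (univ.filter (s17Out f a b c)).card with hBdef
  have hB : ∀ p q : Fin k, 3 ≤ (p : ℕ) → (p : ℕ) + 1 = (q : ℕ) →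
      s17N (TSet f a b c) (Equiv.swap p q) ≤ B := by
    intro p q hp hpq
    unfold s17N
    apply Finset.card_le_card_of_injOn (fun x => x * Equiv.swap p q)
    · intro x hx
      have hx := (Finset.mem_filter.mp hx).2
      refine Finset.mem_filter.mpr ⟨mem_univ _, s17_vmul hx.1.1
        (s17_swapfix p q hp (by omega)), hx.2, p, q, hp, hpq, ?_⟩
      simpa [mul_assoc] using hx.1
    · intro x _ y _ h
      exact mul_right_cancel h
  let G : Finset (Equiv.Perm (Fin k)) := univ.filter (fun g => ∀ x : Fin k, (x : ℕ) < 3 → g x = x)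
  have hN : ∀ g ∈ G, s17N (TSet f a b c) g ≤ 2 * k ^ 2 * B := by
    intro g hg
    have hg := (Finset.mem_filter.mp hg).2
    have := s17N_all (TSet f a b c) B hB k g (fun x hx => hg x (by have := x.2; omega))
    calc _ ≤ _ := this
      _ = _ := by ring
  rw [← Finset.card_product]
  rcases Finset.eq_empty_or_nonempty (univ.filter (TSet f a b c)) with he | ⟨σ0, hσ0⟩
  · rw [he]; simp
  have hσ0 := (Finset.mem_filter.mp hσ0).2
  have hGV : G.card ≤ (univ.filter (VSet a b c)).card := by
    apply Finset.card_le_card_of_injOn (fun g => σ0 * g)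
    · intro g hg
      exact Finset.mem_filter.mpr ⟨mem_univ _, s17_vmul hσ0.1 (Finset.mem_filter.mp hg).2⟩
    · intro x _ y _ h
      exact mul_left_cancel h
  have hinj : (univ.filter (TSet f a b c) ×ˢ
      univ.filter (fun σ => VSet a b c σ ∧ ¬ TSet f a b c σ)).card ≤
      (G.sigma (fun g => univ.filter (fun x => TSet f a b c x ∧ ¬ TSet f a b c (x * g)))).card := by
    apply Finset.card_le_card_of_injOn (fun xy => (⟨xy.1⁻¹ * xy.2, xy.1⟩ : Σ _ : Equiv.Perm (Fin k), Equiv.Perm (Fin k)))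
    · rintro ⟨x, y⟩ hxy
      obtain ⟨hx, hy⟩ := Finset.mem_product.mp hxy
      have hx := (Finset.mem_filter.mp hx).2
      have hy := (Finset.mem_filter.mp hy).2
      refine Finset.mem_sigma.mpr ⟨Finset.mem_filter.mpr ⟨mem_univ _, ?_⟩,
        Finset.mem_filter.mpr ⟨mem_univ _, hx, ?_⟩⟩
      · intro z hz
        obtain ⟨p, q, r, hp, hq, hr, h1, h2, h3⟩ := hx.1
        obtain ⟨p', q', r', hp', hq', hr', h1', h2', h3'⟩ := hy.1
        change x⁻¹ (y z) = z
        rw [Equiv.Perm.inv_eq_iff_eq]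
        have e1 : p' = p := Fin.ext (by omega)
        have e2 : q' = q := Fin.ext (by omega)
        have e3 : r' = r := Fin.ext (by omega)
        subst e1 e2 e3
        have : z = p' ∨ z = q' ∨ z = r' := by simp only [Fin.ext_iff]; omega
        rcases this with rfl | rfl | rfl
        · rw [h1, h1']
        · rw [h2, h2']
        · rw [h3, h3']
      · simpa using hy.2
    · rintro ⟨x, y⟩ _ ⟨x', y'⟩ _ h
      simp only [Sigma.mk.injEq, heq_eq_eq] at h
      obtain ⟨h1, rfl⟩ := h
      rw [mul_left_cancel h1]
  refine hinj.trans ?_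
  rw [Finset.card_sigma]
  calc _ ≤ ∑ g ∈ G, 2 * k ^ 2 * B := Finset.sum_le_sum (fun g hg => hN g hg)
    _ = G.card * (2 * k ^ 2 * B) := by rw [Finset.sum_const, smul_eq_mul]
    _ ≤ _ := Nat.mul_le_mul_right _ hGV

theorem s17_sort {k : ℕ} {a b c : Fin k} (hab : a ≠ b) (hca : c ≠ a) (hcb : c ≠ b)
    (σ : Equiv.Perm (Fin k)) (p q r : Fin k) (hp : (p : ℕ) = 0) (hq : (q : ℕ) = 1)
    (hr : (r : ℕ) = 2) (h : ({σ p, σ q, σ r} : Finset (Fin k)) = {a, b, c}) :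
    ∃ τ : Equiv.Perm (Fin k), VSet a b c τ ∧ ∀ x, σ x ∉ ({a, b, c} : Finset (Fin k)) → τ x = σ x := by
  have ha : a ∈ ({σ p, σ q, σ r} : Finset (Fin k)) := by rw [h]; simp
  have hb : b ∈ ({σ p, σ q, σ r} : Finset (Fin k)) := by rw [h]; simp
  have hc : c ∈ ({σ p, σ q, σ r} : Finset (Fin k)) := by rw [h]; simp
  have hpq : p ≠ q := by intro h; subst h; omega
  have hpr : p ≠ r := by intro h; subst h; omega
  have hqr : q ≠ r := by intro h; subst h; omega
  -- move `a` to the top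
  have hs : ∀ x, σ x ∉ ({a, b, c} : Finset (Fin k)) → x ≠ p ∧ x ≠ q ∧ x ≠ r := by
    intro x hx
    rw [← h] at hx
    simp only [Finset.mem_insert, Finset.mem_singleton, not_or, σ.injective.eq_iff.not] at hx
    exact ⟨fun h => hx.1 (by rw [h]), fun h => hx.2.1 (by rw [h]), fun h => hx.2.2 (by rw [h])⟩
  simp only [Finset.mem_insert, Finset.mem_singleton] at ha hb hc
  have key : ∀ g : Equiv.Perm (Fin k), σ (g p) = a → σ (g q) = b → σ (g r) = c →
      (∀ x, x ≠ p → x ≠ q → x ≠ r → g x = x) →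
      ∃ τ : Equiv.Perm (Fin k), VSet a b c τ ∧
        ∀ x, σ x ∉ ({a, b, c} : Finset (Fin k)) → τ x = σ x := by
    intro g h1 h2 h3 h4
    refine ⟨σ * g, ⟨p, q, r, hp, hq, hr, h1, h2, h3⟩, fun x hx => ?_⟩
    obtain ⟨e1, e2, e3⟩ := hs x hx
    rw [Equiv.Perm.mul_apply, h4 x e1 e2 e3]
  rcases ha with ha | ha | ha <;> rcases hb with hb | hb | hb <;> rcases hc with hc | hc | hc <;>
    first
    | exact absurd (ha.trans hb.symm) hab
    | exact absurd (hc.trans ha.symm) hca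
    | exact absurd (hc.trans hb.symm) hcb
    | skip
  · apply key 1 <;> simp_all
  · apply key (Equiv.swap q r)
    · rw [Equiv.swap_apply_of_ne_of_ne hpq hpr, ha]
    · rw [Equiv.swap_apply_left, hb]
    · rw [Equiv.swap_apply_right, hc]
    · intro x _ h2 h3; exact Equiv.swap_apply_of_ne_of_ne h2 h3
  · apply key (Equiv.swap p q)
    · rw [Equiv.swap_apply_left, ha]
    · rw [Equiv.swap_apply_right, hb]
    · rw [Equiv.swap_apply_of_ne_of_ne hpr.symm hqr.symm, hc]
    · intro x h1 h2 h3; exact Equiv.swap_apply_of_ne_of_ne h1 h2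
  · apply key (Equiv.swap p q * Equiv.swap q r)
    · rw [Equiv.Perm.mul_apply, Equiv.swap_apply_of_ne_of_ne hpq hpr, Equiv.swap_apply_left, ha]
    · rw [Equiv.Perm.mul_apply, Equiv.swap_apply_left,
        Equiv.swap_apply_of_ne_of_ne hpr.symm hqr.symm, hb]
    · rw [Equiv.Perm.mul_apply, Equiv.swap_apply_right, Equiv.swap_apply_right, hc]
    · intro x h1 h2 h3
      rw [Equiv.Perm.mul_apply, Equiv.swap_apply_of_ne_of_ne h2 h3,
        Equiv.swap_apply_of_ne_of_ne h1 h2]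
  · apply key (Equiv.swap q r * Equiv.swap p q)
    · rw [Equiv.Perm.mul_apply, Equiv.swap_apply_left, Equiv.swap_apply_left, ha]
    · rw [Equiv.Perm.mul_apply, Equiv.swap_apply_right,
        Equiv.swap_apply_of_ne_of_ne hpq hpr, hb]
    · rw [Equiv.Perm.mul_apply, Equiv.swap_apply_of_ne_of_ne hpr.symm hqr.symm,
        Equiv.swap_apply_right, hc]
    · intro x h1 h2 h3
      rw [Equiv.Perm.mul_apply, Equiv.swap_apply_of_ne_of_ne h1 h2,
        Equiv.swap_apply_of_ne_of_ne h2 h3]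
  · apply key (Equiv.swap p r)
    · rw [Equiv.swap_apply_left, ha]
    · rw [Equiv.swap_apply_of_ne_of_ne hpq.symm hqr, hb]
    · rw [Equiv.swap_apply_right, hc]
    · intro x h1 h2 h3; exact Equiv.swap_apply_of_ne_of_ne h1 h3

open Classical in
theorem s17_27 {k : ℕ} (hk : 3 ≤ k) (f : Equiv.Perm (Fin k) → Fin k) {a b c : Fin k}
    (hab : a ≠ b) (hca : c ≠ a) (hcb : c ≠ b) :
    (univ.filter (fun σ : Equiv.Perm (Fin k) =>
          IsLocalDict f ({a, b, c} : Finset (Fin k)) σ ∧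
            ∃ p q r : Fin k, (p : ℕ) = 0 ∧ (q : ℕ) = 1 ∧ (r : ℕ) = 2 ∧
              ({σ p, σ q, σ r} : Finset (Fin k)) = {a, b, c})).card ≤
      27 * (univ.filter (TSet f a b c)).card := by
  let p : Fin k := ⟨0, by omega⟩
  let q : Fin k := ⟨1, by omega⟩
  let r : Fin k := ⟨2, by omega⟩
  let H : Finset (Fin k) := {a, b, c}
  have hex : ∀ σ : Equiv.Perm (Fin k), ∃ τ : Equiv.Perm (Fin k),
      ({σ p, σ q, σ r} : Finset (Fin k)) = {a, b, c} →
      VSet a b c τ ∧ ∀ x, σ x ∉ ({a, b, c} : Finset (Fin k)) → τ x = σ x := by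
    intro σ
    by_cases h : ({σ p, σ q, σ r} : Finset (Fin k)) = {a, b, c}
    · obtain ⟨τ, hτ⟩ := s17_sort hab hca hcb σ p q r rfl rfl rfl h
      exact ⟨τ, fun _ => hτ⟩
    · exact ⟨σ, fun h' => absurd h' h⟩
  choose φ hφ using hex
  have hset : ∀ σ : Equiv.Perm (Fin k), (∃ p q r : Fin k, (p : ℕ) = 0 ∧ (q : ℕ) = 1 ∧ (r : ℕ) = 2 ∧
              ({σ p, σ q, σ r} : Finset (Fin k)) = {a, b, c}) →
      ({σ p, σ q, σ r} : Finset (Fin k)) = {a, b, c} := by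
    rintro σ ⟨p', q', r', hp, hq, hr, h⟩
    have e1 : p' = p := Fin.ext hp
    have e2 : q' = q := Fin.ext hq
    have e3 : r' = r := Fin.ext hr
    rw [← e1, ← e2, ← e3]; exact h
  have hH : H.card ≤ 3 := Finset.card_le_three
  have hle : _ ≤ ((H ×ˢ H ×ˢ H) ×ˢ univ.filter (TSet f a b c)).card :=
    Finset.card_le_card_of_injOn (s := univ.filter (fun σ : Equiv.Perm (Fin k) =>
          IsLocalDict f ({a, b, c} : Finset (Fin k)) σ ∧
            ∃ p q r : Fin k, (p : ℕ) = 0 ∧ (q : ℕ) = 1 ∧ (r : ℕ) = 2 ∧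
              ({σ p, σ q, σ r} : Finset (Fin k)) = {a, b, c}))
      (fun σ => ((σ p, σ q, σ r), φ σ)) (by
        intro σ hσ
        obtain ⟨hLD, h⟩ := (Finset.mem_filter.mp hσ).2
        have h := hset σ h
        obtain ⟨hV, hag⟩ := hφ σ h
        simp only [Finset.coe_product, Set.mem_prod, Finset.mem_coe, H, ← h]
        refine ⟨⟨by simp, by simp, by simp⟩, Finset.mem_filter.mpr ⟨mem_univ _, hV, ?_⟩⟩
        exact s17_transfer f _ σ _ hag hLD) (by
        intro σ hσ τ hτ hst
        have h := hset σ (Finset.mem_filter.mp hσ).2.2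
        have h' := hset τ (Finset.mem_filter.mp hτ).2.2
        obtain ⟨hV, hag⟩ := hφ σ h
        obtain ⟨hV', hag'⟩ := hφ τ h'
        simp only [Prod.mk.injEq] at hst
        obtain ⟨⟨e1, e2, e3⟩, e4⟩ := hst
        apply Equiv.ext
        intro x
        by_cases hx : (x : ℕ) < 3
        · have : x = p ∨ x = q ∨ x = r := by simp only [Fin.ext_iff, p, q, r]; omega
          rcases this with rfl | rfl | rfl <;> assumption
        · have m1 : σ x ∉ ({a, b, c} : Finset (Fin k)) := by
            rw [← s17_memiff _ σ (φ σ) hag x, s17_vmem hV]; exact hx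
          have m2 : τ x ∉ ({a, b, c} : Finset (Fin k)) := by
            rw [← s17_memiff _ τ (φ τ) hag' x, s17_vmem hV']; exact hx
          rw [← hag x m1, ← hag' x m2, e4])
  refine hle.trans ?_
  rw [Finset.card_product, Finset.card_product, Finset.card_product]
  apply Nat.mul_le_mul_right
  calc _ ≤ 3 * (3 * 3) := by gcongr
    _ = 27 := by norm_num

open Classical in
theorem s17_out_le {k : ℕ} (f : Equiv.Perm (Fin k) → Fin k) {a b : Fin k}
    (hab : a ≠ b) :
    ∑ c ∈ univ.filter (fun c : Fin k => c ≠ a ∧ c ≠ b), (univ.filter (s17Out f a b c)).card ≤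
      (univ.filter (fun σ : Equiv.Perm (Fin k) => IsMPointR1 2 f σ)).card := by
  have hex : ∀ x : (Σ _ : Fin k, Equiv.Perm (Fin k)), ∃ π' : Equiv.Perm (Fin k),
      (x.1 ≠ a ∧ x.1 ≠ b) → s17Out f a b x.1 x.2 →
      IsMPointR1 2 f π' ∧ ∀ y : Fin k, 3 ≤ (y : ℕ) → π' y = x.2 y := by
    intro x
    by_cases h : (x.1 ≠ a ∧ x.1 ≠ b) ∧ s17Out f a b x.1 x.2
    · obtain ⟨τ, hτ⟩ := s17_manip f hab h.1.1 h.1.2 x.2 h.2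
      exact ⟨τ, fun _ _ => hτ⟩
    · exact ⟨1, fun h1 h2 => absurd ⟨h1, h2⟩ h⟩
  choose φ hφ using hex
  rw [← Finset.card_sigma]
  apply Finset.card_le_card_of_injOn φ
  · intro x hx
    obtain ⟨h1, h2⟩ := Finset.mem_sigma.mp hx
    exact Finset.mem_filter.mpr ⟨mem_univ _,
      (hφ x (Finset.mem_filter.mp h1).2 (Finset.mem_filter.mp h2).2).1⟩
  · rintro ⟨c, π⟩ hx ⟨c', π'⟩ hx' heq
    obtain ⟨h1, h2⟩ := Finset.mem_sigma.mp hx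
    obtain ⟨h1', h2'⟩ := Finset.mem_sigma.mp hx'
    have h1 := (Finset.mem_filter.mp h1).2
    have h2 := (Finset.mem_filter.mp h2).2
    have h1' := (Finset.mem_filter.mp h1').2
    have h2' := (Finset.mem_filter.mp h2').2
    have hag := (hφ _ h1 h2).2
    have hag' := (hφ _ h1' h2').2
    rw [heq] at hag
    have hππ : ∀ y : Fin k, 3 ≤ (y : ℕ) → π y = π' y := fun y hy => by
      have e1 := hag y hy
      have e2 := hag' y hy
      exact e1.symm.trans e2
    have hcc : c = c' := by
      by_contra hne
      have hm : π' (π'.symm c) ∉ ({a, b, c'} : Finset (Fin k)) := by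
        rw [Equiv.apply_symm_apply]
        simp only [Finset.mem_insert, Finset.mem_singleton, not_or]
        exact ⟨h1.1, h1.2, hne⟩
      rw [s17_vmem h2'.1] at hm
      have e := hππ (π'.symm c) (by omega)
      have hm2 : π (π'.symm c) ∈ ({a, b, c} : Finset (Fin k)) := by
        rw [e, Equiv.apply_symm_apply]; simp
      rw [s17_vmem h2.1] at hm2
      exact hm hm2
    subst hcc
    have : π = π' := by
      apply Equiv.ext
      intro x
      by_cases hx : (x : ℕ) < 3
      · obtain ⟨p, q, r, hp, hq, hr, g1, g2, g3⟩ := h2.1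
        obtain ⟨p', q', r', hp', hq', hr', g1', g2', g3'⟩ := h2'.1
        have e1 : p' = p := Fin.ext (by omega)
        have e2 : q' = q := Fin.ext (by omega)
        have e3 : r' = r := Fin.ext (by omega)
        subst e1 e2 e3
        have : x = p' ∨ x = q' ∨ x = r' := by simp only [Fin.ext_iff]; omega
        rcases this with rfl | rfl | rfl
        · exact g1.trans g1'.symm
        · exact g2.trans g2'.symm
        · exact g3.trans g3'.symm
      · exact hππ x (by omega)
    rw [this]

open Classical in
theorem s17_out_ge {k : ℕ} (hk : 3 ≤ k) (ε : ℝ) (f : Equiv.Perm (Fin k) → Fin k)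
    (a b c : Fin k)
    (h : prob (fun σ : Equiv.Perm (Fin k) => TSet f a b c σ) /
          prob (fun σ : Equiv.Perm (Fin k) => VSet a b c σ) ≤ 1 - ε / (100 * (k : ℝ))) :
    ((univ.filter (TSet f a b c)).card : ℝ) * (ε / (200 * (k : ℝ) ^ 3)) ≤
      ((univ.filter (s17Out f a b c)).card : ℝ) := by
  have hiso := s17_iso f a b c
  have hk0 : (0 : ℝ) < k := by exact_mod_cast (by omega : 0 < k)
  rw [s17_prob_eq, s17_prob_eq] at h
  have hcard : (0 : ℝ) < Fintype.card (Equiv.Perm (Fin k)) := by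
    exact_mod_cast Fintype.card_pos
  rw [div_div_div_cancel_right₀ hcard.ne'] at h
  have hsplit : (univ.filter (TSet f a b c)).card +
      (univ.filter (fun σ => VSet a b c σ ∧ ¬ TSet f a b c σ)).card =
      (univ.filter (VSet a b c)).card := by
    rw [← Finset.card_filter_add_card_filter_not (s := univ.filter (VSet a b c)) (TSet f a b c),
      Finset.filter_filter, Finset.filter_filter]
    congr 2
    ext σ
    simp only [Finset.mem_filter, Finset.mem_univ, true_and]
    exact ⟨fun h => ⟨h.1, h⟩, fun h => h.2⟩
  change ((univ.filter (TSet f a b c)).card : ℝ) / ((univ.filter (VSet a b c)).card : ℝ) ≤ _ at h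
  generalize (univ.filter (TSet f a b c)).card = t at *
  generalize (univ.filter (VSet a b c)).card = v at *
  generalize (univ.filter (s17Out f a b c)).card = B at *
  generalize (univ.filter (fun σ => VSet a b c σ ∧ ¬ TSet f a b c σ)).card = u at *
  rcases Nat.eq_zero_or_pos v with hv | hv
  · have : t = 0 := by omega
    subst this
    simp
  have hv' : (0 : ℝ) < v := by exact_mod_cast hv
  rw [div_le_iff₀ hv'] at h
  have hs : (t : ℝ) + u = v := by exact_mod_cast hsplit
  have hiso' : (t : ℝ) * u ≤ v * (2 * k ^ 2 * B) := by exact_mod_cast hiso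
  have hu : ε / (100 * k) * v ≤ u := by linarith
  have h3 : (t : ℝ) * (ε / (100 * k) * v) ≤ v * (2 * k ^ 2 * B) :=
    (mul_le_mul_of_nonneg_left hu (Nat.cast_nonneg t)).trans hiso'
  have h4 : (t : ℝ) * (ε / (100 * k)) ≤ 2 * k ^ 2 * B := by
    apply le_of_mul_le_mul_left _ hv'
    linarith
  have h5 : (t : ℝ) * (ε / (200 * (k : ℝ) ^ 3)) = (t : ℝ) * (ε / (100 * k)) / (2 * k ^ 2) := by
    field_simp; ring
  rw [h5, div_le_iff₀ (by positivity)]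
  linarith

theorem stmt17 (k : ℕ) (hk : 3 ≤ k) (ε : ℝ) (hε0 : 0 < ε) (hε1 : ε ≤ 1)
    (a b : Fin k) (hab : a ≠ b) (f : Equiv.Perm (Fin k) → Fin k)
    (h1 : ε ^ 2 / (4 * (k : ℝ) ^ 11) ≤
      ∑ c ∈ Finset.univ.filter (fun c : Fin k => c ≠ a ∧ c ≠ b),
        prob (fun σ : Equiv.Perm (Fin k) =>
          IsLocalDict f ({a, b, c} : Finset (Fin k)) σ ∧
            ∃ p q r : Fin k, (p : ℕ) = 0 ∧ (q : ℕ) = 1 ∧ (r : ℕ) = 2 ∧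
              ({σ p, σ q, σ r} : Finset (Fin k)) = {a, b, c}))
    (h2 : ∀ c : Fin k, c ≠ a → c ≠ b →
      prob (fun σ : Equiv.Perm (Fin k) => TSet f a b c σ) /
          prob (fun σ : Equiv.Perm (Fin k) => VSet a b c σ) ≤ 1 - ε / (100 * (k : ℝ))) :
    ε ^ 3 / (10 ^ 5 * (k : ℝ) ^ 16) ≤
      prob (fun σ : Equiv.Perm (Fin k) => IsMPointR1 2 f σ) := by
  classical
  have hk0 : (0 : ℝ) < k := by exact_mod_cast (by omega : 0 < k)
  have hk3 : (3 : ℝ) ≤ k := by exact_mod_cast hk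
  have hcard : (0 : ℝ) < Fintype.card (Equiv.Perm (Fin k)) := by
    exact_mod_cast Fintype.card_pos
  simp only [s17_prob_eq] at h1
  rw [s17_prob_eq]
  rw [← Finset.sum_div, le_div_iff₀ hcard] at h1
  rw [le_div_iff₀ hcard]
  set F := (Fintype.card (Equiv.Perm (Fin k)) : ℝ)
  have hmain : (∑ c ∈ univ.filter (fun c : Fin k => c ≠ a ∧ c ≠ b),
      ((univ.filter (s17Out f a b c)).card : ℝ)) ≤
      ((univ.filter (fun σ : Equiv.Perm (Fin k) => IsMPointR1 2 f σ)).card : ℝ) := by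
    exact_mod_cast s17_out_le f hab
  refine le_trans ?_ hmain
  have hT : ε ^ 2 / (4 * (k : ℝ) ^ 11) * F ≤
      ∑ c ∈ univ.filter (fun c : Fin k => c ≠ a ∧ c ≠ b),
        27 * ((univ.filter (TSet f a b c)).card : ℝ) := by
    refine h1.trans (Finset.sum_le_sum fun c hc => ?_)
    obtain ⟨hca, hcb⟩ := (Finset.mem_filter.mp hc).2
    exact_mod_cast s17_27 hk f hab hca hcb
  have hO : ∑ c ∈ univ.filter (fun c : Fin k => c ≠ a ∧ c ≠ b),
        ((univ.filter (TSet f a b c)).card : ℝ) * (ε / (200 * (k : ℝ) ^ 3)) ≤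
      ∑ c ∈ univ.filter (fun c : Fin k => c ≠ a ∧ c ≠ b),
      ((univ.filter (s17Out f a b c)).card : ℝ) := by
    refine Finset.sum_le_sum fun c hc => ?_
    obtain ⟨hca, hcb⟩ := (Finset.mem_filter.mp hc).2
    exact s17_out_ge hk ε f a b c (h2 c hca hcb)
  refine le_trans ?_ hO
  rw [← Finset.mul_sum] at hT
  rw [← Finset.sum_mul]
  have hδ : 0 ≤ ε / (200 * (k : ℝ) ^ 3) / 27 := by positivity
  have h3 := mul_le_mul_of_nonneg_right hT hδ
  refine le_trans ?_ (h3.trans_eq (by ring))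
  have h4 : ε ^ 2 / (4 * (k : ℝ) ^ 11) * F * (ε / (200 * (k : ℝ) ^ 3) / 27) =
      ε ^ 3 / (21600 * (k : ℝ) ^ 14) * F := by
    field_simp; norm_num
  rw [h4]
  apply mul_le_mul_of_nonneg_right _ hcard.le
  apply div_le_div_of_nonneg_left (by positivity) (by positivity)
  have h5 : (1 : ℝ) ≤ k ^ 2 := by nlinarith
  have h6 : (k : ℝ) ^ 14 ≤ k ^ 16 := pow_le_pow_right₀ (by linarith) (by norm_num)
  have h7 : (0 : ℝ) ≤ k ^ 16 := by positivity
  linarith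
end

section
/- Let k ≥ 3 and 0 < ε ≤ 1, and let f : S_k → [k] be an SCF on one voter with D(f, NONMANIP(1,k)) ≥ ε. Suppose K ⊆ [k] satisfies |K| ≥ 3, for every c ∈ K one has P^{(c)}(f(σ) = c) ≥ 1 − ε/(50k), and for every d ∉ K one has P(f(σ) = d) ≤ ε/(4k). Then P(σ ∈ M_2(f)) ≥ ε/(4k^2). -/
open Finset

lemma prob_mono_aux {Ω : Type*} [Fintype Ω] {p q : Ω → Prop} (h : ∀ x, p x → q x) :
    prob p ≤ prob q := by
  classical
  unfold prob
  gcongr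
  intro hx
  exact h _ hx

lemma prob_nonneg_aux {Ω : Type*} [Fintype Ω] (p : Ω → Prop) : 0 ≤ prob p := by
  unfold prob
  positivity

lemma prob_or_aux {Ω : Type*} [Fintype Ω] (p q : Ω → Prop) :
    prob (fun x => p x ∨ q x) ≤ prob p + prob q := by
  classical
  unfold prob
  rw [← add_div]
  gcongr
  have h := Finset.card_union_le (Finset.univ.filter p) (Finset.univ.filter q)
  rw [← Finset.filter_or] at h
  rw [← Nat.cast_add]
  refine Nat.cast_le.mpr (le_trans (le_of_eq ?_) h)
  congr 1
  ext x
  simp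

lemma prob_exists_aux {Ω ι : Type*} [Fintype Ω] (s : Finset ι) (p : ι → Ω → Prop) :
    prob (fun x => ∃ i ∈ s, p i x) ≤ ∑ i ∈ s, prob (p i) := by
  classical
  induction s using Finset.induction_on with
  | empty => simp [prob]
  | insert a s ha ih =>
    rw [Finset.sum_insert ha]
    refine le_trans (prob_mono_aux (q := fun x => p a x ∨ ∃ i ∈ s, p i x) ?_)
      ((prob_or_aux _ _).trans (by gcongr))
    intro x hx
    simpa using hx

lemma prob_inj_aux {Ω : Type*} [Fintype Ω] (p : Ω → Prop) (φ : Ω → Ω)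
    (hφ : Function.Injective φ) : prob (fun x => p (φ x)) ≤ prob p := by
  classical
  unfold prob
  refine div_le_div_of_nonneg_right (Nat.cast_le.mpr ?_) (Nat.cast_nonneg _)
  refine Finset.card_le_card_of_injOn φ ?_ (hφ.injOn)
  intro x hx
  simpa using hx

/-- bad event at level `j`. -/
def BadAt {k : ℕ} (f : Equiv.Perm (Fin k) → Fin k) (K : Finset (Fin k)) (j : ℕ)
    (σ : Equiv.Perm (Fin k)) : Prop :=
  f σ ∈ K ∧ ∃ p : Fin k, (p : ℕ) = j ∧ σ p ∈ K ∧ (∀ q, q < p → σ q ∉ K) ∧ f σ ≠ σ p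

lemma bad_step_point {k : ℕ} (f : Equiv.Perm (Fin k) → Fin k) (K : Finset (Fin k))
    (p q : Fin k) (hpq : (q : ℕ) + 1 = p) (σ : Equiv.Perm (Fin k))
    (hB : BadAt f K p σ) :
    (IsMPointR1 2 f σ ∨ IsMPointR1 2 f (σ * Equiv.swap q p)) ∨
      BadAt f K q (σ * Equiv.swap q p) := by
  by_contra hcon
  push Not at hcon
  obtain ⟨⟨hM1, hM2⟩, hnB⟩ := hcon
  obtain ⟨hfK, p', hp', hpK, hlt, hne⟩ := hB
  obtain rfl : p' = p := Fin.ext hp'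
  have hqp : q ≠ p' := by intro h; subst h; omega
  have hblk : ∀ x : Fin k, ((x : ℕ) < q ∨ (q : ℕ) + 2 ≤ x) →
      σ x = (σ * Equiv.swap q p') x := by
    intro x hx
    rw [Equiv.Perm.mul_apply, Equiv.swap_apply_of_ne_of_ne]
    · intro h; subst h; omega
    · intro h; subst h; omega
  have hneσ : σ ≠ σ * Equiv.swap q p' := by
    intro h
    have := congrArg (fun t => t q) h
    simp at this
    exact hqp this
  set π := σ * Equiv.swap q p' with hπ
  have hsymm : ∀ x, π.symm x = Equiv.swap q p' (σ.symm x) := by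
    intro x
    rw [Equiv.symm_apply_eq, hπ]
    simp
  have a1 : ¬ Above σ (f π) (f σ) := fun h => hM1 ⟨π, hneσ, h, q, hblk⟩
  have a2 : ¬ Above π (f σ) (f π) :=
    fun h => hM2 ⟨σ, hneσ.symm, h, q, fun x hx => (hblk x hx).symm⟩
  unfold Above at a1 a2
  have hu : p' < σ.symm (f σ) := by
    by_contra h
    rcases lt_or_eq_of_le (not_lt.mp h) with h | h
    · exact hlt _ h (by simpa using hfK)
    · exact hne (by rw [← h]; simp)
  have hv : p' < σ.symm (f π) := lt_of_lt_of_le hu (not_lt.mp a1)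
  have hq : q < p' := by rw [Fin.lt_def]; omega
  rw [hsymm, hsymm, Equiv.swap_apply_of_ne_of_ne (hq.trans hu).ne' hu.ne',
    Equiv.swap_apply_of_ne_of_ne (hq.trans hv).ne' hv.ne'] at a2
  have he : f σ = f π := σ.symm.injective (le_antisymm (not_lt.mp a1) (not_lt.mp a2))
  have hπq : π q = σ p' := by simp [hπ]
  refine hnB ⟨he ▸ hfK, q, rfl, ?_, ?_, ?_⟩
  · rwa [hπq]
  · intro r hr
    rw [← hblk r (Or.inl hr)]
    exact hlt r (hr.trans hq)
  · rw [hπq, ← he]; exact hne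

lemma bad_step {k : ℕ} (f : Equiv.Perm (Fin k) → Fin k) (K : Finset (Fin k)) (j : ℕ) :
    prob (BadAt f K (j + 1)) ≤ prob (BadAt f K j) + 2 * prob (IsMPointR1 2 f) := by
  by_cases hj : j + 1 < k
  · let p : Fin k := ⟨j + 1, hj⟩
    let q : Fin k := ⟨j, by omega⟩
    have hinj : Function.Injective (fun σ : Equiv.Perm (Fin k) => σ * Equiv.swap q p) :=
      mul_left_injective _
    have e1 := prob_mono_aux (bad_step_point f K p q rfl)
    have e2 := prob_or_aux (fun σ => IsMPointR1 2 f σ ∨ IsMPointR1 2 f (σ * Equiv.swap q p))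
      (fun σ => BadAt f K q (σ * Equiv.swap q p))
    have e3 := prob_or_aux (fun σ => IsMPointR1 2 f σ)
      (fun σ => IsMPointR1 2 f (σ * Equiv.swap q p))
    have e4 := prob_inj_aux (IsMPointR1 2 f) _ hinj
    have e5 := prob_inj_aux (BadAt f K q) _ hinj
    change prob (BadAt f K p) ≤ prob (BadAt f K q) + 2 * prob (IsMPointR1 2 f)
    change _ ≤ prob (fun σ => IsMPointR1 2 f σ) + _ at e3
    linarith
  · have : prob (BadAt f K (j + 1)) ≤ prob (BadAt f K j) := by
      apply prob_mono_aux
      rintro σ ⟨-, p, hp, -⟩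
      have := p.2
      omega
    linarith [prob_nonneg_aux (IsMPointR1 2 f)]

lemma bad_le {k : ℕ} (f : Equiv.Perm (Fin k) → Fin k) (K : Finset (Fin k)) (j : ℕ) :
    prob (BadAt f K j) ≤ prob (BadAt f K 0) + 2 * j * prob (IsMPointR1 2 f) := by
  induction j with
  | zero => simp
  | succ j ih =>
    have := bad_step f K j
    push_cast
    linarith

lemma exists_top {k : ℕ} (K : Finset (Fin k)) (hK : K.Nonempty) :
    ∃ g : Equiv.Perm (Fin k) → Fin k, IsTop1 g K ∧
      ∀ σ : Equiv.Perm (Fin k), ∃ p, σ p = g σ ∧ ∀ q, q < p → σ q ∉ K := by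
  have : ∀ σ : Equiv.Perm (Fin k), ∃ a ∈ K, ∀ b ∈ K, σ.symm a ≤ σ.symm b :=
    fun σ => Finset.exists_min_image K _ hK
  choose g hg hmin using this
  refine ⟨g, fun σ => ⟨hg σ, fun b hb hne => ?_⟩, fun σ => ⟨σ.symm (g σ), by simp, ?_⟩⟩
  · exact lt_of_le_of_ne (hmin σ b hb) (fun h => hne (σ.symm.injective h).symm)
  · intro q hq hqK
    have := hmin σ _ hqK
    simp at this
    exact absurd hq (not_lt.mpr this)

lemma sum_first {k : ℕ} (hk : 0 < k) :
    ∑ c : Fin k, prob (fun σ : Equiv.Perm (Fin k) => ∃ p : Fin k, (p : ℕ) = 0 ∧ σ p = c) = 1 := by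
  classical
  have hcard : (0 : ℝ) < Fintype.card (Equiv.Perm (Fin k)) := by
    exact_mod_cast Fintype.card_pos
  unfold prob
  rw [← Finset.sum_div, div_eq_one_iff_eq hcard.ne']
  have h := Finset.card_eq_sum_card_fiberwise (s := (Finset.univ : Finset (Equiv.Perm (Fin k))))
    (t := (Finset.univ : Finset (Fin k))) (f := fun σ => σ ⟨0, hk⟩) (fun _ _ => by simp)
  rw [← Finset.card_univ, h]
  push_cast
  refine Finset.sum_congr rfl fun c _ => ?_
  congr 2
  ext σ
  simp only [Finset.mem_filter, Finset.mem_univ, true_and]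
  constructor
  · rintro ⟨p, hp, h⟩
    obtain rfl : p = ⟨0, hk⟩ := Fin.ext hp
    exact h
  · intro h
    exact ⟨_, rfl, h⟩

theorem stmt18 (k : ℕ) (hk : 3 ≤ k) (ε : ℝ) (hε0 : 0 < ε) (hε1 : ε ≤ 1)
    (f : Equiv.Perm (Fin k) → Fin k)
    (hD : ∀ g : Equiv.Perm (Fin k) → Fin k, InNonManip1 g →
      ε ≤ prob (fun σ : Equiv.Perm (Fin k) => f σ ≠ g σ))
    (K : Finset (Fin k)) (hK : 3 ≤ K.card)
    (h1 : ∀ c ∈ K, 1 - ε / (50 * (k : ℝ)) ≤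
      prob (fun σ : Equiv.Perm (Fin k) => f σ = c ∧ ∃ p : Fin k, (p : ℕ) = 0 ∧ σ p = c) /
        prob (fun σ : Equiv.Perm (Fin k) => ∃ p : Fin k, (p : ℕ) = 0 ∧ σ p = c))
    (h2 : ∀ d : Fin k, d ∉ K →
      prob (fun σ : Equiv.Perm (Fin k) => f σ = d) ≤ ε / (4 * (k : ℝ))) :
    ε / (4 * (k : ℝ) ^ 2) ≤ prob (fun σ : Equiv.Perm (Fin k) => IsMPointR1 2 f σ) := by
  have hk0 : 0 < k := by omega
  have hkR : (3 : ℝ) ≤ k := by exact_mod_cast hk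
  have hKne : K.Nonempty := Finset.card_pos.mp (by omega)
  obtain ⟨g, hg, hgp⟩ := exists_top K hKne
  have hdist := hD g (Or.inl ⟨K, hKne, hg⟩)
  set m := prob (fun σ : Equiv.Perm (Fin k) => IsMPointR1 2 f σ) with hm
  have hm0 : 0 ≤ m := prob_nonneg_aux _
  -- the bad event at the top
  have hB0 : prob (BadAt f K 0) ≤ ε / (50 * (k : ℝ)) := by
    have hs : prob (BadAt f K 0) ≤ ∑ c ∈ K, prob (fun σ : Equiv.Perm (Fin k) =>
        f σ ≠ c ∧ ∃ p : Fin k, (p : ℕ) = 0 ∧ σ p = c) := by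
      refine le_trans (prob_mono_aux ?_) (prob_exists_aux K _)
      rintro σ ⟨-, p, hp, hpK, -, hne⟩
      exact ⟨σ p, hpK, hne, p, hp, rfl⟩
    have hδ : 0 ≤ ε / (50 * (k : ℝ)) := by positivity
    have hc : ∀ c ∈ K, prob (fun σ : Equiv.Perm (Fin k) =>
        f σ ≠ c ∧ ∃ p : Fin k, (p : ℕ) = 0 ∧ σ p = c) ≤ ε / (50 * (k : ℝ)) *
        prob (fun σ : Equiv.Perm (Fin k) => ∃ p : Fin k, (p : ℕ) = 0 ∧ σ p = c) := by
      intro c hcK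
      have hh := h1 c hcK
      have hsplit : prob (fun σ : Equiv.Perm (Fin k) =>
            f σ ≠ c ∧ ∃ p : Fin k, (p : ℕ) = 0 ∧ σ p = c) +
          prob (fun σ : Equiv.Perm (Fin k) => f σ = c ∧ ∃ p : Fin k, (p : ℕ) = 0 ∧ σ p = c) =
          prob (fun σ : Equiv.Perm (Fin k) => ∃ p : Fin k, (p : ℕ) = 0 ∧ σ p = c) := by
        classical
        unfold prob
        rw [← add_div]
        congr 1
        rw [← Nat.cast_add]
        congr 1
        rw [← Finset.card_union_of_disjoint]
        · congr 1
          ext σ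
          simp only [Finset.mem_union, Finset.mem_filter, Finset.mem_univ, true_and]
          generalize (∃ p : Fin k, (p : ℕ) = 0 ∧ σ p = c) = Q
          by_cases hfc : f σ = c <;> simp [hfc]
        · rw [Finset.disjoint_left]
          intro σ ha hb
          simp only [Finset.mem_filter, Finset.mem_univ, true_and] at ha hb
          exact ha.1 hb.1
      have hn := prob_nonneg_aux (fun σ : Equiv.Perm (Fin k) =>
        f σ = c ∧ ∃ p : Fin k, (p : ℕ) = 0 ∧ σ p = c)
      rcases (prob_nonneg_aux (fun σ : Equiv.Perm (Fin k) =>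
        ∃ p : Fin k, (p : ℕ) = 0 ∧ σ p = c)).eq_or_lt with h0 | h0
      · rw [← h0] at hsplit ⊢
        linarith
      · rw [le_div_iff₀ h0] at hh
        linarith
    have hsub : ∑ c ∈ K, prob (fun σ : Equiv.Perm (Fin k) =>
        ∃ p : Fin k, (p : ℕ) = 0 ∧ σ p = c) ≤ 1 := by
      rw [← sum_first hk0]
      exact Finset.sum_le_sum_of_subset_of_nonneg (Finset.subset_univ _)
        (fun _ _ _ => prob_nonneg_aux _)
    have := Finset.sum_le_sum hc
    rw [← Finset.mul_sum] at this
    nlinarith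
  -- decomposition
  have hdec : prob (fun σ : Equiv.Perm (Fin k) => f σ ≠ g σ) ≤
      ∑ d ∈ Kᶜ, prob (fun σ : Equiv.Perm (Fin k) => f σ = d) +
      ∑ j ∈ Finset.range k, prob (BadAt f K j) := by
    refine le_trans (prob_mono_aux ?_) ((prob_or_aux _ _).trans
      (add_le_add (prob_exists_aux _ _) (prob_exists_aux _ _)))
    intro σ hσ
    by_cases h : f σ ∈ K
    · right
      obtain ⟨p, hp, hlt⟩ := hgp σ
      exact ⟨p, Finset.mem_range.mpr p.2, h, p, rfl, hp ▸ (hg σ).1, hlt, hp ▸ hσ⟩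
    · left
      exact ⟨f σ, by simpa using h, rfl⟩
  have hd : ∑ d ∈ Kᶜ, prob (fun σ : Equiv.Perm (Fin k) => f σ = d) ≤ ε / 4 := by
    have e1 := Finset.sum_le_card_nsmul Kᶜ
      (fun d => prob (fun σ : Equiv.Perm (Fin k) => f σ = d)) _
      (fun d hd => h2 d (by simpa using hd))
    have e2 : (Kᶜ.card : ℝ) ≤ k := by
      have := Finset.card_le_univ Kᶜ
      rw [Fintype.card_fin] at this
      exact_mod_cast this
    rw [nsmul_eq_mul] at e1
    refine e1.trans ?_
    calc (Kᶜ.card : ℝ) * (ε / (4 * k)) ≤ k * (ε / (4 * k)) := by gcongr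
      _ = ε / 4 := by field_simp
  have hb : ∑ j ∈ Finset.range k, prob (BadAt f K j) ≤ ε / 50 + 2 * k ^ 2 * m := by
    have e1 : ∀ j ∈ Finset.range k, prob (BadAt f K j) ≤ ε / (50 * (k : ℝ)) + 2 * k * m := by
      intro j hj
      have hjk : (j : ℝ) ≤ k := by exact_mod_cast (Finset.mem_range.mp hj).le
      refine (bad_le f K j).trans ?_
      change _ + 2 * (j : ℝ) * m ≤ _
      gcongr
    have e2 := Finset.sum_le_card_nsmul _ _ _ e1
    rw [nsmul_eq_mul, Finset.card_range] at e2
    refine e2.trans (le_of_eq ?_)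
    field_simp
  have hfin : ε ≤ 4 * (k : ℝ) ^ 2 * m := by
    nlinarith
  rw [div_le_iff₀ (by positivity)]
  linarith
end

section
/- Let k ≥ 3 and 0 < ε ≤ 1, let a ≠ b be alternatives, and let f : S_k → [k] be an SCF on one voter with D(f, NONMANIP(1,k)) ≥ ε. If P(σ ∈ B | σ ∈ F̄) > 1 − ε/(4k), then either P(σ ∈ M_2(f)) ≥ ε/(4k^2) or P(σ ∈ LD(a,b)) ≥ ε/(4k^2). -/
open Finset

/-- Move alternative `b` one position down, if possible. -/
noncomputable def downStep {k : ℕ} (b : Fin k) (σ : Equiv.Perm (Fin k)) : Equiv.Perm (Fin k) :=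
  if h : (σ.symm b : ℕ) + 1 < k then σ * Equiv.swap (σ.symm b) ⟨(σ.symm b : ℕ) + 1, h⟩ else σ

lemma chain_lemma {k : ℕ} (f : Equiv.Perm (Fin k) → Fin k) (a b : Fin k) (n : ℕ) :
    ∀ σ : Equiv.Perm (Fin k), (σ.symm a : ℕ) + 1 + n = (σ.symm b : ℕ) → f σ ≠ a →
      ∃ j, j ≤ n ∧ ∃ π, (IsMPointR1 2 f π ∨ (Fbar a b π ∧ f π ≠ a)) ∧
        (downStep b)^[j] π = σ := by
  induction n with
  | zero =>
    intro σ h hf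
    exact ⟨0, le_rfl, σ, Or.inr ⟨by simpa [Fbar] using h, hf⟩, rfl⟩
  | succ n ih =>
    intro σ h hf
    obtain ⟨q, hq⟩ : ∃ q, q = σ.symm b := ⟨_, rfl⟩
    have hqk := q.isLt
    obtain ⟨p, hp⟩ : ∃ p : Fin k, (p : ℕ) + 1 = q := ⟨⟨(q : ℕ) - 1, by omega⟩, by
      simp only [hq]; omega⟩
    have hpq : p ≠ q := by intro e; rw [e] at hp; omega
    obtain ⟨τ, hτ⟩ : ∃ τ, τ = σ * Equiv.swap p q := ⟨_, rfl⟩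
    have hsymm : ∀ x, τ.symm x = Equiv.swap p q (σ.symm x) := by
      intro x
      rw [Equiv.symm_apply_eq, hτ]
      simp
    have hlt : ∀ x, σ.symm x < p → τ.symm x = σ.symm x := by
      intro x hx
      rw [hsymm]
      apply Equiv.swap_apply_of_ne_of_ne
      · exact ne_of_lt hx
      · intro e; rw [e, Fin.lt_def] at hx; omega
    have hap : σ.symm a < p := by rw [Fin.lt_def]; rw [← hq] at h; omega
    have hτb : τ.symm b = p := by rw [hsymm, ← hq]; simp
    have hτa := hlt a hap
    have hστ : σ ≠ τ := by
      intro e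
      rw [← e, ← hq] at hτb
      exact hpq hτb.symm
    have hDown : downStep b τ = σ := by
      have e : (⟨(p : ℕ) + 1, by omega⟩ : Fin k) = q := Fin.ext hp
      have hpk : (p : ℕ) + 1 < k := by omega
      unfold downStep
      simp only [hτb, hpk, dif_pos]
      rw [e, hτ, mul_assoc, Equiv.swap_mul_self, mul_one]
    have hag : ∀ x : Fin k, ((x : ℕ) < p ∨ p + 2 ≤ (x : ℕ)) → σ x = τ x := by
      intro x hx
      rw [hτ, Equiv.Perm.mul_apply, Equiv.swap_apply_of_ne_of_ne]
      · intro e; rw [e] at hx; omega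
      · intro e; rw [e] at hx; omega
    by_cases hfτ : f τ = a
    · rcases lt_trichotomy (σ.symm a) (σ.symm (f σ)) with hl | he | hg
      · refine ⟨0, by omega, σ, Or.inl ⟨τ, hστ, ?_, p, hag⟩, rfl⟩
        rw [hfτ]; exact hl
      · exact absurd (σ.symm.injective he).symm hf
      · refine ⟨1, by omega, τ, Or.inl ⟨σ, hστ.symm, ?_, p, fun x hx => (hag x hx).symm⟩, hDown⟩
        rw [hfτ]
        unfold Above
        rw [hτa, hlt _ (hg.trans hap)]
        exact hg
    · obtain ⟨j, hj, π, hπ, e⟩ := ih τ (by rw [hτa, hτb]; rw [← hq] at h; omega) hfτ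
      refine ⟨j + 1, by omega, π, hπ, ?_⟩
      rw [Function.iterate_succ_apply', e, hDown]

open Classical in
lemma card_chain {k : ℕ} (f : Equiv.Perm (Fin k) → Fin k) (a b : Fin k) :
    (univ.filter (fun σ : Equiv.Perm (Fin k) => Above σ a b ∧ f σ ≠ a)).card ≤
      k * ((univ.filter (fun σ => IsMPointR1 2 f σ)).card +
        (univ.filter (fun σ => Fbar a b σ ∧ f σ ≠ a)).card) := by
  have hsub : univ.filter (fun σ : Equiv.Perm (Fin k) => Above σ a b ∧ f σ ≠ a) ⊆
      (Finset.range k).biUnion (fun j =>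
        (univ.filter (fun σ => IsMPointR1 2 f σ) ∪
          univ.filter (fun σ => Fbar a b σ ∧ f σ ≠ a)).image (downStep b)^[j]) := by
    intro σ hσ
    simp only [mem_filter, mem_univ, true_and] at hσ
    obtain ⟨h1, h2⟩ := hσ
    unfold Above at h1
    rw [Fin.lt_def] at h1
    have := (σ.symm b).isLt
    obtain ⟨j, hj, π, hπ, e⟩ := chain_lemma f a b ((σ.symm b : ℕ) - (σ.symm a + 1)) σ (by omega) h2
    simp only [mem_biUnion, mem_range, mem_image, mem_union, mem_filter, mem_univ, true_and]
    exact ⟨j, by omega, π, hπ, e⟩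
  refine (card_le_card hsub).trans ?_
  refine (card_biUnion_le_card_mul _ _ _ (fun j _ => card_image_le.trans (card_union_le _ _))).trans ?_
  rw [card_range]

lemma fbar_swap {k : ℕ} (a b : Fin k) (σ : Equiv.Perm (Fin k)) (h : Fbar b a σ) :
    Fbar a b (Equiv.swap a b * σ) := by
  have hs : ∀ x, (Equiv.swap a b * σ).symm x = σ.symm (Equiv.swap a b x) := by
    intro x
    rw [Equiv.symm_apply_eq]
    simp
  unfold Fbar at *
  simpa [hs] using h

theorem stmt19 (k : ℕ) (hk : 3 ≤ k) (ε : ℝ) (hε0 : 0 < ε) (hε1 : ε ≤ 1)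
    (a b : Fin k) (hab : a ≠ b) (f : Equiv.Perm (Fin k) → Fin k)
    (hD : ∀ g : Equiv.Perm (Fin k) → Fin k, InNonManip1 g →
      ε ≤ prob (fun σ : Equiv.Perm (Fin k) => f σ ≠ g σ))
    (h : 1 - ε / (4 * (k : ℝ)) <
      prob (fun σ : Equiv.Perm (Fin k) => BSet f a b σ ∧ Fbar a b σ) /
        prob (fun σ : Equiv.Perm (Fin k) => Fbar a b σ)) :
    ε / (4 * (k : ℝ) ^ 2) ≤ prob (fun σ : Equiv.Perm (Fin k) => IsMPointR1 2 f σ) ∨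
      ε / (4 * (k : ℝ) ^ 2) ≤ prob (fun σ : Equiv.Perm (Fin k) => InLD f a b σ) := by
  classical
  set N := (univ.filter (fun σ : Equiv.Perm (Fin k) => Fbar a b σ ∧ ¬ BSet f a b σ)).card with hN
  set M := (univ.filter (fun σ : Equiv.Perm (Fin k) => IsMPointR1 2 f σ)).card with hM
  have h1 : (univ.filter (fun σ : Equiv.Perm (Fin k) => Fbar a b σ ∧ f σ ≠ a)).card ≤ N := by
    apply card_le_card
    intro σ hσ
    simp only [mem_filter, mem_univ, true_and] at hσ ⊢
    exact ⟨hσ.1, fun hB => hσ.2 hB.1⟩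
  have h2 : (univ.filter (fun σ : Equiv.Perm (Fin k) => Fbar b a σ ∧ f σ ≠ b)).card ≤ N := by
    apply card_le_card_of_injOn (fun σ => Equiv.swap a b * σ)
    · intro σ hσ
      simp only [coe_filter, mem_univ, true_and, Set.mem_ofPred_eq] at hσ ⊢
      have hF := fbar_swap a b σ hσ.1
      refine ⟨hF, fun hB => hσ.2 ?_⟩
      have h3 := hB.2.1
      unfold adjSwap at h3
      unfold Fbar at hF
      rw [if_pos (Or.inl hF), ← mul_assoc, Equiv.swap_mul_self, one_mul] at h3
      exact h3
    · intro x _ y _ hxy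
      exact mul_left_cancel hxy
  have c1 := card_chain f a b
  have c2 := card_chain f b a
  let g : Equiv.Perm (Fin k) → Fin k := fun σ => if Above σ a b then a else b
  have hg : InNonManip1 g := by
    left
    refine ⟨{a, b}, ⟨a, by simp⟩, fun σ => ?_⟩
    by_cases hA : Above σ a b
    · have e : g σ = a := if_pos hA
      rw [e]
      refine ⟨by simp, fun c hc hne => ?_⟩
      simp only [mem_insert, mem_singleton] at hc
      rcases hc with rfl | rfl
      · exact absurd rfl hne
      · exact hA
    · have e : g σ = b := if_neg hA
      rw [e]
      refine ⟨by simp, fun c hc hne => ?_⟩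
      simp only [mem_insert, mem_singleton] at hc
      rcases hc with rfl | rfl
      · unfold Above at *
        exact lt_of_le_of_ne (not_lt.mp hA) (fun e => hne (σ.symm.injective e).symm)
      · exact absurd rfl hne
  have hc : (univ.filter (fun σ : Equiv.Perm (Fin k) => f σ ≠ g σ)).card ≤
      2 * k * M + 2 * k * N := by
    have hsub : univ.filter (fun σ : Equiv.Perm (Fin k) => f σ ≠ g σ) ⊆
        univ.filter (fun σ : Equiv.Perm (Fin k) => Above σ a b ∧ f σ ≠ a) ∪
        univ.filter (fun σ : Equiv.Perm (Fin k) => Above σ b a ∧ f σ ≠ b) := by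
      intro σ hσ
      simp only [mem_union, mem_filter, mem_univ, true_and] at hσ ⊢
      by_cases hA : Above σ a b
      · have e : g σ = a := if_pos hA
        rw [e] at hσ
        exact Or.inl ⟨hA, hσ⟩
      · have e : g σ = b := if_neg hA
        rw [e] at hσ
        refine Or.inr ⟨?_, hσ⟩
        unfold Above at *
        exact lt_of_le_of_ne (not_lt.mp hA) (fun e => hab (σ.symm.injective e).symm)
    calc _ ≤ _ := card_le_card hsub
      _ ≤ _ := card_union_le _ _
      _ ≤ k * (M + N) + k * (M + N) := by
        refine Nat.add_le_add (c1.trans ?_) (c2.trans ?_)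
        · exact Nat.mul_le_mul_left _ (Nat.add_le_add_left h1 _)
        · exact Nat.mul_le_mul_left _ (Nat.add_le_add_left h2 _)
      _ = _ := by ring
  have hsplit : (univ.filter (fun σ : Equiv.Perm (Fin k) => BSet f a b σ ∧ Fbar a b σ)).card + N =
      (univ.filter (fun σ : Equiv.Perm (Fin k) => Fbar a b σ)).card := by
    rw [hN, ← card_filter_add_card_filter_not (s := univ.filter (fun σ => Fbar a b σ))
      (fun σ => BSet f a b σ), filter_filter, filter_filter]
    simp only [and_comm]
  have hFT : (univ.filter (fun σ : Equiv.Perm (Fin k) => Fbar a b σ)).card ≤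
      Fintype.card (Equiv.Perm (Fin k)) := card_le_univ _
  left
  by_contra hlt
  rw [not_le] at hlt
  have hd := hD g hg
  unfold prob at h hlt hd
  have eqF : ∀ (p : Equiv.Perm (Fin k) → Prop) (i1 i2 : DecidablePred p),
      (@Finset.filter _ p i1 univ).card = (@Finset.filter _ p i2 univ).card := by
    intros; congr!
  set T : ℝ := (Fintype.card (Equiv.Perm (Fin k)) : ℝ) with hT
  have hTpos : 0 < T := by rw [hT]; exact_mod_cast Fintype.card_pos
  set F := (univ.filter (fun σ : Equiv.Perm (Fin k) => Fbar a b σ)).card with hF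
  set B := (univ.filter (fun σ : Equiv.Perm (Fin k) => BSet f a b σ ∧ Fbar a b σ)).card with hB
  have h' : 1 - ε / (4 * (k : ℝ)) < ((B : ℝ) / T) / ((F : ℝ) / T) := by
    convert h
  have hlt' : (M : ℝ) / T < ε / (4 * (k : ℝ) ^ 2) := by
    convert hlt
  have hd' : ε ≤ ((univ.filter (fun σ : Equiv.Perm (Fin k) => f σ ≠ g σ)).card : ℝ) / T := by
    convert hd
  have hk' : (3 : ℝ) ≤ k := by exact_mod_cast hk
  have hkpos : (0 : ℝ) < k := by linarith
  have hcR : ((univ.filter (fun σ : Equiv.Perm (Fin k) => f σ ≠ g σ)).card : ℝ) ≤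
      2 * k * M + 2 * k * N := by exact_mod_cast hc
  have hsR : (B : ℝ) + N = F := by exact_mod_cast hsplit
  have hFR : (F : ℝ) ≤ T := by rw [hT]; exact_mod_cast hFT
  rw [le_div_iff₀ hTpos] at hd'
  rw [div_lt_iff₀ hTpos] at hlt'
  rw [div_div_div_cancel_right₀ hTpos.ne'] at h'
  have hF0 : (0 : ℝ) ≤ F := Nat.cast_nonneg _
  have hNF : 4 * k * (N : ℝ) ≤ ε * F := by
    rcases hF0.eq_or_lt with h0 | h0
    · have hB0 : (0 : ℝ) ≤ B := Nat.cast_nonneg _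
      have : (N : ℝ) ≤ 0 := by linarith
      rw [← h0]; nlinarith
    · rw [lt_div_iff₀ h0] at h'
      have e : (1 - ε / (4 * (k : ℝ))) * F = F - ε * F / (4 * k) := by ring
      rw [e] at h'
      have : (N : ℝ) ≤ ε * F / (4 * k) := by linarith
      rw [le_div_iff₀ (by positivity)] at this
      linarith
  have hMk : 4 * k * k * (M : ℝ) < ε * T := by
    have e : ε / (4 * (k : ℝ) ^ 2) * T = ε * T / (4 * k ^ 2) := by ring
    rw [e, lt_div_iff₀ (by positivity)] at hlt'
    linarith
  have hεT : 0 < ε * T := mul_pos hε0 hTpos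
  have hεF : ε * F ≤ ε * T := mul_le_mul_of_nonneg_left hFR hε0.le
  have hM0 : (0 : ℝ) ≤ k * M := by positivity
  nlinarith
end
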